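/- arXiv:1011.4591 — 3 statements merged into one kernel-verified Lean document; each statement's English description precedes it below -/
import Mathlib

section
/- Let τ ∈ ℂ with Im τ > 0. For all (u, v, x, y) ∈ ℂ⁴ at which all occurring values of σ, σ', σ'' are defined (i.e. u, v, u+v ∉ Λ and x, y, x+y ∉ Λ), the Kronecker function satisfies the identity σ'(u, x+y)·σ'(v, y) − σ'(u, x)·σ'(u+v, y) − σ'(−v, x)·σ'(u+v, x+y) = σ(u, x)·σ''(u+v, y) − σ(−v, x)·σ''(u+v, x+y). -/
open Complex Matrix
open scoped TensorProduct

noncomputable section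

/-- π as a complex number. -/
def πc : ℂ := Real.pi

/-- The lattice Λ = ℤ + τℤ ⊂ ℂ. -/
def latticeL (τ : ℂ) : Set ℂ := {x | ∃ m k : ℤ, x = (m : ℂ) + (k : ℂ) * τ}

/-- Σ_B = {λ − λ' : exp(2πiλ), exp(2πiλ') eigenvalues of B} + Λ. -/
def SigmaSet (n : ℕ) (τ : ℂ) (B : Matrix (Fin n) (Fin n) ℂ) : Set ℂ :=
  {x | ∃ l l' : ℂ, Complex.exp (2 * πc * I * l) ∈ spectrum ℂ B ∧
    Complex.exp (2 * πc * I * l') ∈ spectrum ℂ B ∧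
    ∃ w ∈ latticeL τ, x = l - l' + w}

/-- First Jacobi theta function θ₁(z|τ) = 2q^{1/4} Σ_{m≥0} (−1)^m q^{m(m+1)} sin((2m+1)πz),
with q = exp(πiτ). -/
def theta1 (τ z : ℂ) : ℂ :=
  2 * Complex.exp (πc * I * τ / 4) *
    ∑' m : ℕ, (-1 : ℂ) ^ m * Complex.exp (πc * I * τ * (m * (m + 1))) *
      Complex.sin ((2 * (m : ℂ) + 1) * πc * z)

/-- Third Jacobi theta function θ₃(z|τ) = Σ_{m∈ℤ} exp(πim²τ + 2πimz). -/
def theta3 (τ z : ℂ) : ℂ :=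
  ∑' m : ℤ, Complex.exp (πc * I * (m : ℂ) ^ 2 * τ + 2 * πc * I * (m : ℂ) * z)

/-- The Kronecker function σ(u,x) = θ'(0)θ(u+x)/(θ(u)θ(x)). -/
def kron (τ u x : ℂ) : ℂ :=
  deriv (theta1 τ) 0 * theta1 τ (u + x) / (theta1 τ u * theta1 τ x)

/-- σ'(u,x): first partial derivative of the Kronecker function in the first variable. -/
def kron' (τ u x : ℂ) : ℂ := deriv (fun w => kron τ w x) u

/-- σ''(u,x): second partial derivative of the Kronecker function in the first variable. -/
def kron'' (τ u x : ℂ) : ℂ := deriv (deriv fun w => kron τ w x) u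

open Function in
/-- The product of two theta functions of modulus `τ` in terms of theta functions of
modulus `2τ`, obtained by splitting the double sum according to parity. -/
lemma jacobiTheta₂_mul_jacobiTheta₂ {τ : ℂ} (hτ : 0 < τ.im) (s t : ℂ) :
    jacobiTheta₂ s τ * jacobiTheta₂ t τ =
      jacobiTheta₂ (s + t) (2 * τ) * jacobiTheta₂ (s - t) (2 * τ) +
        Complex.exp (2 * Real.pi * I * s + Real.pi * I * τ) *
          (jacobiTheta₂ (s + t + τ) (2 * τ) * jacobiTheta₂ (s - t + τ) (2 * τ)) := by
  have hτ2 : 0 < (2 * τ).im := by simpa using hτ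
  have prodSum (σ a b : ℂ) (hσ : 0 < σ.im) :
      HasSum (fun p : ℤ × ℤ => jacobiTheta₂_term p.1 a σ * jacobiTheta₂_term p.2 b σ)
        (jacobiTheta₂ a σ * jacobiTheta₂ b σ) := by
    have ha := hasSum_jacobiTheta₂_term a hσ
    have hb := hasSum_jacobiTheta₂_term b hσ
    have hab := summable_mul_of_summable_norm ha.summable.norm hb.summable.norm
    exact HasSum.mul (f := (jacobiTheta₂_term · a σ)) (g := (jacobiTheta₂_term · b σ)) ha hb hab
  let F : ℤ × ℤ → ℂ := fun p => jacobiTheta₂_term p.1 s τ * jacobiTheta₂_term p.2 t τ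
  let e : ℤ × ℤ → ℤ × ℤ := fun p => (p.1 + p.2, p.1 - p.2)
  let o : ℤ × ℤ → ℤ × ℤ := fun p => (p.1 + p.2 + 1, p.1 - p.2)
  have he : Injective e := by
    rintro ⟨a, b⟩ ⟨c, d⟩ h
    simp only [e, Prod.mk.injEq] at h ⊢
    omega
  have ho : Injective o := by
    rintro ⟨a, b⟩ ⟨c, d⟩ h
    simp only [o, Prod.mk.injEq] at h ⊢
    omega
  have hcompl : IsCompl (Set.range e) (Set.range o) := by
    refine IsCompl.of_eq ?_ ?_
    · refine Set.eq_empty_of_forall_notMem ?_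
      rintro _ ⟨⟨⟨a, b⟩, rfl⟩, ⟨⟨c, d⟩, h⟩⟩
      simp only [e, o, Prod.mk.injEq] at h
      omega
    · refine Set.eq_univ_of_forall ?_
      rintro ⟨m, n⟩
      rcases Int.even_or_odd (m + n) with ⟨k, hk⟩ | ⟨k, hk⟩
      · exact Or.inl ⟨(k, k - n), Prod.ext (by simp only [e]; omega) (by simp only [e]; omega)⟩
      · exact Or.inr ⟨(k, k - n), Prod.ext (by simp only [o]; omega) (by simp only [o]; omega)⟩
  have hFe : HasSum (F ∘ e)
      (jacobiTheta₂ (s + t) (2 * τ) * jacobiTheta₂ (s - t) (2 * τ)) := by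
    refine (prodSum (2 * τ) (s + t) (s - t) hτ2).congr_fun fun p => ?_
    simp only [F, e, Function.comp_apply, jacobiTheta₂_term, ← Complex.exp_add]
    congr 1
    push_cast
    ring
  have hFo : HasSum (F ∘ o) (Complex.exp (2 * Real.pi * I * s + Real.pi * I * τ) *
      (jacobiTheta₂ (s + t + τ) (2 * τ) * jacobiTheta₂ (s - t + τ) (2 * τ))) := by
    refine ((prodSum (2 * τ) (s + t + τ) (s - t + τ) hτ2).mul_left _).congr_fun fun p => ?_
    simp only [F, o, Function.comp_apply, jacobiTheta₂_term, ← Complex.exp_add]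
    congr 1
    push_cast
    ring
  refine (prodSum τ s t hτ).unique ?_
  exact HasSum.add_isCompl hcompl (he.hasSum_range_iff.mpr hFe) (ho.hasSum_range_iff.mpr hFo)

lemma theta1_eq_jacobiTheta₂ {τ : ℂ} (hτ : 0 < τ.im) (z : ℂ) :
    theta1 τ z = -I * Complex.exp (Real.pi * I * (τ / 4 + z)) * jacobiTheta₂ (z + 1 / 2 + τ / 2) τ := by
  have h := ((hasSum_jacobiTheta₂_term (z + 1 / 2 + τ / 2) hτ).nat_add_neg_add_one).mul_left
    (-I * Complex.exp (Real.pi * I * (τ / 4 + z)))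
  rw [← h.tsum_eq, theta1, ← tsum_mul_left]
  refine tsum_congr fun m => ?_
  have h1 : jacobiTheta₂_term m (z + 1 / 2 + τ / 2) τ =
      (-1) ^ m * Complex.exp (πc * I * τ * (m * (m + 1))) * Complex.exp (2 * m * πc * I * z) := by
    rw [← Complex.exp_pi_mul_I, ← Complex.exp_nat_mul, ← Complex.exp_add, ← Complex.exp_add,
      jacobiTheta₂_term]
    congr 1
    simp only [πc]
    push_cast
    ring
  have h2 : jacobiTheta₂_term (-(m + 1 : ℤ)) (z + 1 / 2 + τ / 2) τ =
      -((-1) ^ m * Complex.exp (πc * I * τ * (m * (m + 1))) * Complex.exp (-(2 * m + 2) * πc * I * z)) := by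
    have : (-1 : ℂ) ^ m = -Complex.exp (-(m + 1 : ℕ) * (Real.pi * I)) := by
      rw [neg_mul, Complex.exp_neg, Complex.exp_nat_mul, Complex.exp_pi_mul_I, ← inv_pow]
      norm_num [pow_succ]
    rw [this, neg_mul, neg_mul, neg_neg, ← Complex.exp_add, ← Complex.exp_add, jacobiTheta₂_term]
    congr 1
    simp only [πc]
    push_cast
    ring
  have h3 : Complex.exp (Real.pi * I * (τ / 4 + z)) = Complex.exp (πc * I * τ / 4) * Complex.exp (πc * I * z) := by
    rw [← Complex.exp_add]
    congr 1
    simp only [πc]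
    ring
  have h4 : Complex.exp ((2 * (m : ℂ) + 1) * πc * z * I) =
      Complex.exp (πc * I * z) * Complex.exp (2 * m * πc * I * z) := by
    rw [← Complex.exp_add]; congr 1; ring
  have h5 : Complex.exp (-((2 * (m : ℂ) + 1) * πc * z) * I) =
      Complex.exp (πc * I * z) * Complex.exp (-(2 * m + 2) * πc * I * z) := by
    rw [← Complex.exp_add]; congr 1; ring
  rw [h1, h2, h3, Complex.sin, h4, h5]
  ring

lemma differentiable_jacobiTheta₂_fst {τ : ℂ} (hτ : 0 < τ.im) :
    Differentiable ℂ (jacobiTheta₂ · τ) :=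
  fun z => differentiableAt_jacobiTheta₂_fst z hτ

lemma differentiable_theta1 {τ : ℂ} (hτ : 0 < τ.im) : Differentiable ℂ (theta1 τ) := by
  rw [funext (theta1_eq_jacobiTheta₂ hτ)]
  have := differentiable_jacobiTheta₂_fst hτ
  exact Differentiable.mul (by fun_prop) (this.comp (g := (jacobiTheta₂ · τ))
    (f := fun z => z + 1 / 2 + τ / 2) (by fun_prop))

lemma theta1_neg (τ z : ℂ) : theta1 τ (-z) = -theta1 τ z := by
  simp only [theta1, mul_neg, Complex.sin_neg, tsum_neg]

/-- For fixed modulus `τ` some value of the theta function is nonzero, because its zeroth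
Fourier coefficient is `1`. -/
lemma exists_jacobiTheta₂_ne_zero {τ : ℂ} (hτ : 0 < τ.im) : ∃ z, jacobiTheta₂ z τ ≠ 0 := by
  by_contra! h
  have hs := intervalIntegral.hasSum_integral_of_dominated_convergence
    (μ := MeasureTheory.volume) (a := 0) (b := 1)
    (F := fun (n : ℤ) (x : ℝ) => jacobiTheta₂_term n x τ) (f := fun x : ℝ => jacobiTheta₂ x τ)
    (fun n _ => ‖jacobiTheta₂_term n 0 τ‖)
    (fun n => (by unfold jacobiTheta₂_term; fun_prop :
      Continuous fun x : ℝ => jacobiTheta₂_term n x τ).aestronglyMeasurable)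
    (fun n => .of_forall fun x _ => by simp [norm_jacobiTheta₂_term])
    (.of_forall fun x _ => (hasSum_jacobiTheta₂_term 0 hτ).summable.norm)
    (by simp)
    (.of_forall fun x _ => hasSum_jacobiTheta₂_term x hτ)
  have h0 (n : ℤ) (hn : n ≠ 0) : ∫ x in (0 : ℝ)..1, jacobiTheta₂_term n x τ = 0 := by
    have hc : 2 * Real.pi * I * n ≠ 0 := by simp [hn, Real.pi_ne_zero]
    simp only [jacobiTheta₂_term, Complex.exp_add]
    rw [intervalIntegral.integral_mul_const, integral_exp_mul_complex hc]
    simp [mul_comm _ (n : ℂ), Complex.exp_int_mul_two_pi_mul_I]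
  have := (hasSum_single 0 h0).unique hs
  simp [h, jacobiTheta₂_term] at this

/-- The half `θ₃(2x|2τ)` of the addition formula for `theta1`. -/
def thetaA (τ x : ℂ) : ℂ := jacobiTheta₂ (2 * x) (2 * τ)

/-- The half `θ₂(2x|2τ)` of the addition formula for `theta1`. -/
def thetaB (τ x : ℂ) : ℂ :=
  Complex.exp (Real.pi * I * (2 * x + τ / 2)) * jacobiTheta₂ (2 * x + τ) (2 * τ)

lemma theta1_add_mul_theta1_sub {τ : ℂ} (hτ : 0 < τ.im) (x y : ℂ) :
    theta1 τ (x + y) * theta1 τ (x - y) =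
      thetaA τ x * thetaB τ y - thetaB τ x * thetaA τ y := by
  rw [theta1_eq_jacobiTheta₂ hτ, theta1_eq_jacobiTheta₂ hτ,
    mul_mul_mul_comm, jacobiTheta₂_mul_jacobiTheta₂ hτ]
  have e1 : x + y + 1 / 2 + τ / 2 + (x - y + 1 / 2 + τ / 2) = 2 * x + τ + 1 := by ring
  have e2 : x + y + 1 / 2 + τ / 2 - (x - y + 1 / 2 + τ / 2) = 2 * y := by ring
  have e3 : 2 * x + τ + 1 + τ = 2 * x + 2 * τ + 1 := by ring
  rw [e1, e2, e3, jacobiTheta₂_add_left, jacobiTheta₂_add_left, jacobiTheta₂_add_left',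
    thetaA, thetaA, thetaB, thetaB]
  have e4 : -I * Complex.exp (Real.pi * I * (τ / 4 + (x + y))) *
      (-I * Complex.exp (Real.pi * I * (τ / 4 + (x - y)))) =
        -Complex.exp (Real.pi * I * (2 * x + τ / 2)) := by
    rw [mul_mul_mul_comm, ← Complex.exp_add]
    simp only [neg_mul_neg, I_mul_I, neg_one_mul]
    congr 2
    ring
  have e5 : Complex.exp (Real.pi * I * (2 * x + τ / 2)) *
      (Complex.exp (2 * Real.pi * I * (x + y + 1 / 2 + τ / 2) + Real.pi * I * τ) *
        Complex.exp (-Real.pi * I * (2 * τ + 2 * (2 * x)))) =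
      -Complex.exp (Real.pi * I * (2 * y + τ / 2)) := by
    rw [← Complex.exp_add, ← Complex.exp_add, ← neg_one_mul (Complex.exp _),
      ← Complex.exp_pi_mul_I, ← Complex.exp_add]
    congr 1
    ring
  rw [e4]
  linear_combination (-jacobiTheta₂ (2 * x) (2 * τ) * jacobiTheta₂ (2 * y + τ) (2 * τ)) * e5

lemma theta1_three_term {τ : ℂ} (hτ : 0 < τ.im) (u v x y : ℂ) :
    theta1 τ (u + x + y) * theta1 τ (v + y) * theta1 τ (u + v) * theta1 τ x -
        theta1 τ (u + x) * theta1 τ (u + v + y) * theta1 τ v * theta1 τ (x + y) -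
        theta1 τ (x - v) * theta1 τ (u + v + x + y) * theta1 τ u * theta1 τ y = 0 := by
  have h (a b p r : ℂ) (hp : p + r = a) (hr : p - r = b) : theta1 τ a * theta1 τ b =
      thetaA τ p * thetaB τ r - thetaB τ p * thetaA τ r := by
    rw [← hp, ← hr, theta1_add_mul_theta1_sub hτ]
  have h1 := h (u + x + y) x (x + (u + y) / 2) ((u + y) / 2) (by ring) (by ring)
  have h2 := h (v + y) (u + v) (v + (u + y) / 2) ((y - u) / 2) (by ring) (by ring)
  have h3 := h (x + y) (u + x) (x + (u + y) / 2) ((y - u) / 2) (by ring) (by ring)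
  have h4 := h (u + v + y) v (v + (u + y) / 2) ((u + y) / 2) (by ring) (by ring)
  have h5 := h (u + v + x + y) (x - v) (x + (u + y) / 2) (v + (u + y) / 2) (by ring) (by ring)
  have h6 := h y u ((u + y) / 2) ((y - u) / 2) (by ring) (by ring)
  have e : (theta1 τ (u + x + y) * theta1 τ x) * (theta1 τ (v + y) * theta1 τ (u + v)) -
      (theta1 τ (x + y) * theta1 τ (u + x)) * (theta1 τ (u + v + y) * theta1 τ v) -
      (theta1 τ (u + v + x + y) * theta1 τ (x - v)) * (theta1 τ y * theta1 τ u) = 0 := by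
    rw [h1, h2, h3, h4, h5, h6]
    ring
  linear_combination e

lemma thetaA_add_half (τ x : ℂ) : thetaA τ (x + 1 / 2) = thetaA τ x := by
  rw [thetaA, thetaA, ← jacobiTheta₂_add_left (2 * x)]
  congr 1
  ring

lemma thetaB_add_half (τ x : ℂ) : thetaB τ (x + 1 / 2) = -thetaB τ x := by
  have e1 : 2 * (x + 1 / 2) + τ = 2 * x + τ + 1 := by ring
  have e2 : Real.pi * I * (2 * (x + 1 / 2) + τ / 2) =
    Real.pi * I * (2 * x + τ / 2) + Real.pi * I := by ring
  rw [thetaB, thetaB, e1, e2, jacobiTheta₂_add_left, Complex.exp_add, Complex.exp_pi_mul_I]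
  ring

lemma thetaA_add_half_period (τ x : ℂ) :
    thetaA τ (x + τ / 2) = Complex.exp (-(Real.pi * I * (2 * x + τ / 2))) * thetaB τ x := by
  rw [thetaA, thetaB, ← mul_assoc, ← Complex.exp_add, neg_add_cancel, Complex.exp_zero, one_mul]
  congr 1
  ring

lemma thetaB_add_half_period (τ x : ℂ) :
    thetaB τ (x + τ / 2) = Complex.exp (-(Real.pi * I * (2 * x + τ / 2))) * thetaA τ x := by
  have e1 : 2 * (x + τ / 2) + τ = 2 * x + 2 * τ := by ring
  rw [thetaA, thetaB, e1, jacobiTheta₂_add_left', ← mul_assoc, ← Complex.exp_add]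
  congr 2
  ring

lemma differentiable_thetaA {τ : ℂ} (hτ : 0 < τ.im) : Differentiable ℂ (thetaA τ) :=
  (differentiable_jacobiTheta₂_fst (τ := 2 * τ) (by simpa using hτ)).comp
    (f := fun x => 2 * x) (by fun_prop)

lemma differentiable_thetaB {τ : ℂ} (hτ : 0 < τ.im) : Differentiable ℂ (thetaB τ) :=
  Differentiable.mul (by fun_prop)
    ((differentiable_jacobiTheta₂_fst (τ := 2 * τ) (by simpa using hτ)).comp
      (f := fun x => 2 * x + τ) (by fun_prop))

lemma exists_theta1_ne_zero {τ : ℂ} (hτ : 0 < τ.im) : ∃ z, theta1 τ z ≠ 0 := by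
  by_contra! h
  obtain ⟨z, hz⟩ := exists_jacobiTheta₂_ne_zero (τ := 2 * τ) (by simpa using hτ)
  have hA : thetaA τ (z / 2) ≠ 0 := by rwa [thetaA, mul_div_cancel₀ z two_ne_zero]
  have hB : thetaB τ (z / 2 + τ / 2) ≠ 0 := by
    rw [thetaB_add_half_period]
    exact mul_ne_zero (Complex.exp_ne_zero _) hA
  have h1 := theta1_add_mul_theta1_sub hτ (z / 2) (z / 2 + τ / 2)
  have h2 := theta1_add_mul_theta1_sub hτ (z / 2 + 1 / 2) (z / 2 + τ / 2)
  rw [h, zero_mul] at h1 h2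
  rw [thetaA_add_half, thetaB_add_half] at h2
  exact mul_ne_zero hA hB (by linear_combination -(h1 + h2) / 2)

lemma thetaA_ne_zero_or_thetaB_ne_zero {τ : ℂ} (hτ : 0 < τ.im) (x : ℂ) :
    thetaA τ x ≠ 0 ∨ thetaB τ x ≠ 0 := by
  by_contra! ⟨hA, hB⟩
  have hd := differentiable_theta1 hτ
  have h := AnalyticOnNhd.eq_zero_or_eq_zero_of_mul_eq_zero (U := Set.univ)
    (f := fun y => theta1 τ (x + y)) (g := fun y => theta1 τ (x - y))
    (fun y _ => (hd.comp (f := fun y => x + y) (by fun_prop)).analyticAt y)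
    (fun y _ => (hd.comp (f := fun y => x - y) (by fun_prop)).analyticAt y)
    (fun y _ => by simp [theta1_add_mul_theta1_sub hτ, hA, hB]) isPreconnected_univ
  obtain ⟨z, hz⟩ := exists_theta1_ne_zero hτ
  rcases h with h | h
  · exact hz (by simpa using h (z - x) trivial)
  · exact hz (by simpa using h (x - z) trivial)

/-- Liouville's theorem for an entire function with doubly periodic absolute value. -/
lemma Differentiable.eq_of_periodic_norm {τ : ℂ} (hτ : 0 < τ.im) {f : ℂ → ℂ}
    (hf : Differentiable ℂ f) (h1 : Function.Periodic (fun z => ‖f z‖) 1)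
    (h2 : Function.Periodic (fun z => ‖f z‖) τ) (z w : ℂ) : f z = f w := by
  refine hf.apply_eq_apply_of_bounded ?_ z w
  let K : Set ℂ := (fun p : ℝ × ℝ => (p.1 : ℂ) + p.2 * τ) '' (Set.Icc 0 1 ×ˢ Set.Icc 0 1)
  have hK : IsCompact K := (isCompact_Icc.prod isCompact_Icc).image (by fun_prop)
  obtain ⟨C, hC⟩ := hK.exists_bound_of_continuousOn hf.continuous.continuousOn
  refine isBounded_iff_forall_norm_le.mpr ⟨C, ?_⟩
  rintro _ ⟨z, rfl⟩
  let t : ℝ := z.im / τ.im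
  let s : ℝ := z.re - t * τ.re
  have hz : z = s + t * τ := by
    apply Complex.ext
    · simp [s]
    · simp [t, hτ.ne']
  have e : z = (Int.fract s + Int.fract t * τ : ℂ) + ⌊s⌋ * 1 + ⌊t⌋ * τ := by
    rw [hz, ← Int.floor_add_fract s, ← Int.floor_add_fract t]
    push_cast
    simp
    ring
  have h3 := h2.int_mul ⌊t⌋ ((Int.fract s + Int.fract t * τ : ℂ) + ⌊s⌋ * 1)
  have h4 := h1.int_mul ⌊s⌋ (Int.fract s + Int.fract t * τ : ℂ)
  rw [e]
  refine (h3.trans h4).trans_le (hC _ ⟨(Int.fract s, Int.fract t), ⟨⟨Int.fract_nonneg s, (Int.fract_lt_one s).le⟩,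
    ⟨Int.fract_nonneg t, (Int.fract_lt_one t).le⟩⟩, rfl⟩)

/-- The zeros of `theta1` all lie in the lattice. -/
lemma theta1_ne_zero {τ : ℂ} (hτ : 0 < τ.im) {a : ℂ} (ha : a ∉ latticeL τ) :
    theta1 τ a ≠ 0 := by
  intro h0
  have hcross (x : ℂ) : thetaA τ (x + a) * thetaB τ x = thetaB τ (x + a) * thetaA τ x := by
    have := theta1_add_mul_theta1_sub hτ (x + a) x
    rw [add_sub_cancel_left, h0, mul_zero] at this
    linear_combination -this
  have hAB := thetaA_ne_zero_or_thetaB_ne_zero hτ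
  have hexists (x : ℂ) : ∃ c, thetaA τ (x + a) = c * thetaA τ x ∧
      thetaB τ (x + a) = c * thetaB τ x := by
    rcases hAB x with h | h
    · exact ⟨thetaA τ (x + a) / thetaA τ x, by field_simp, by
        field_simp; linear_combination -hcross x⟩
    · exact ⟨thetaB τ (x + a) / thetaB τ x, by
        field_simp; linear_combination hcross x, by field_simp⟩
  choose c hcA hcB using hexists
  have hunique {x p q : ℂ} (h1 : p * thetaA τ x = q * thetaA τ x)
      (h2 : p * thetaB τ x = q * thetaB τ x) : p = q := by
    rcases hAB x with h | h
    · exact mul_right_cancel₀ h h1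
    · exact mul_right_cancel₀ h h2
  have hc : Differentiable ℂ c := by
    have key {f : ℂ → ℂ} (hf : Differentiable ℂ f) (hcf : ∀ x, f (x + a) = c x * f x) (x : ℂ)
        (hx : f x ≠ 0) : DifferentiableAt ℂ c x := by
      have hd : DifferentiableAt ℂ (fun y => f (y + a) / f y) x :=
        (hf.comp (f := fun y => y + a) (by fun_prop) x).div (hf x) hx
      refine hd.congr_of_eventuallyEq ?_
      filter_upwards [hf.continuous.continuousAt.eventually_ne hx] with y hy
      rw [hcf, mul_div_cancel_right₀ _ hy]
    intro x
    rcases hAB x with h | h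
    · exact key (differentiable_thetaA hτ) hcA x h
    · exact key (differentiable_thetaB hτ) hcB x h
  have hc_ne (x : ℂ) : c x ≠ 0 := by
    intro h
    rcases hAB (x + a) with h' | h'
    · exact h' (by rw [hcA, h, zero_mul])
    · exact h' (by rw [hcB, h, zero_mul])
  have hc_half (x : ℂ) : c (x + 1 / 2) = c x := by
    have e : x + 1 / 2 + a = x + a + 1 / 2 := by ring
    have h1 := hcA (x + 1 / 2)
    have h2 := hcB (x + 1 / 2)
    rw [e, thetaA_add_half, thetaA_add_half, hcA] at h1
    rw [e, thetaB_add_half, thetaB_add_half, hcB] at h2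
    exact hunique h1.symm (by linear_combination h2)
  have hc_half_period (x : ℂ) :
      c (x + τ / 2) = Complex.exp (-(2 * Real.pi * I * a)) * c x := by
    have e : x + τ / 2 + a = x + a + τ / 2 := by ring
    have e' : Complex.exp (-(Real.pi * I * (2 * (x + a) + τ / 2))) =
        Complex.exp (-(Real.pi * I * (2 * x + τ / 2))) *
          Complex.exp (-(2 * Real.pi * I * a)) := by
      rw [← Complex.exp_add]; congr 1; ring
    have h1 := hcA (x + τ / 2)
    have h2 := hcB (x + τ / 2)
    rw [e, thetaA_add_half_period, thetaA_add_half_period, hcB, e'] at h1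
    rw [e, thetaB_add_half_period, thetaB_add_half_period, hcA, e'] at h2
    refine hunique (x := x) (mul_left_cancel₀ (Complex.exp_ne_zero
      (-(Real.pi * I * (2 * x + τ / 2)))) ?_) (mul_left_cancel₀ (Complex.exp_ne_zero
      (-(Real.pi * I * (2 * x + τ / 2)))) ?_)
    · linear_combination -h2
    · linear_combination -h1
  let t : ℝ := a.im / τ.im
  let s : ℝ := a.re - t * τ.re
  have ha' : a = s + t * τ := by
    apply Complex.ext
    · simp [s]
    · simp [t, hτ.ne']
  let g : ℂ → ℂ := fun x => c x * Complex.exp (4 * Real.pi * I * t * x)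
  have hg : Differentiable ℂ g := hc.mul (by fun_prop)
  have hg1 (x : ℂ) : g (x + 1 / 2) = Complex.exp ((2 * Real.pi * t : ℝ) * I) * g x := by
    have : Complex.exp (4 * Real.pi * I * t * (x + 1 / 2)) =
        Complex.exp ((2 * Real.pi * t : ℝ) * I) * Complex.exp (4 * Real.pi * I * t * x) := by
      rw [← Complex.exp_add]; congr 1; push_cast; ring
    simp only [g]
    rw [hc_half, this]
    ring
  have hg2 (x : ℂ) : g (x + τ / 2) = Complex.exp ((-(2 * Real.pi * s) : ℝ) * I) * g x := by
    have : Complex.exp (-(2 * Real.pi * I * a)) *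
        Complex.exp (4 * Real.pi * I * t * (x + τ / 2)) =
        Complex.exp ((-(2 * Real.pi * s) : ℝ) * I) * Complex.exp (4 * Real.pi * I * t * x) := by
      rw [← Complex.exp_add, ← Complex.exp_add, ha']; congr 1; push_cast; ring
    simp only [g]
    rw [hc_half_period]
    linear_combination c x * this
  have hconst (x : ℂ) : g x = g 0 := by
    refine hg.eq_of_periodic_norm hτ (fun z => ?_) (fun z => ?_) x 0
    · have : z + 1 = z + 1 / 2 + 1 / 2 := by ring
      simp only [this, hg1, norm_mul, Complex.norm_exp_ofReal_mul_I, one_mul]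
    · have : z + τ = z + τ / 2 + τ / 2 := by ring
      simp only [this, hg2, norm_mul, Complex.norm_exp_ofReal_mul_I, one_mul]
  have hg0 : g 0 ≠ 0 := mul_ne_zero (hc_ne 0) (Complex.exp_ne_zero _)
  have exists_int (r : ℝ) (hr : Complex.exp ((2 * Real.pi * r : ℝ) * I) = 1) : ∃ n : ℤ, (r : ℂ) = n := by
    obtain ⟨n, hn⟩ := Complex.exp_eq_one_iff.mp hr
    refine ⟨n, mul_right_cancel₀ Complex.two_pi_I_ne_zero ?_⟩
    rw [← hn]
    push_cast
    ring
  have ht : Complex.exp ((2 * Real.pi * t : ℝ) * I) = 1 := by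
    have := hg1 0
    rw [hconst] at this
    exact mul_right_cancel₀ hg0 (by rw [← this, one_mul])
  have hs : Complex.exp ((2 * Real.pi * s : ℝ) * I) = 1 := by
    have := hg2 0
    rw [hconst] at this
    have h1 := mul_right_cancel₀ hg0 ((one_mul (g 0)).trans this)
    rwa [ofReal_neg, neg_mul, Complex.exp_neg, eq_comm, inv_eq_one] at h1
  obtain ⟨n, hn⟩ := exists_int t ht
  obtain ⟨m, hm⟩ := exists_int s hs
  exact ha ⟨m, n, by rw [ha', hn, hm]⟩

lemma neg_mem_latticeL {τ x : ℂ} (hx : -x ∈ latticeL τ) : x ∈ latticeL τ := by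
  obtain ⟨m, k, h⟩ := hx
  exact ⟨-m, -k, by push_cast; linear_combination -h⟩

lemma isOpen_compl_theta1_zeros {τ : ℂ} (hτ : 0 < τ.im) : IsOpen {z | theta1 τ z ≠ 0} :=
  isOpen_ne_fun (differentiable_theta1 hτ).continuous continuous_const

lemma differentiableOn_kron {τ : ℂ} (hτ : 0 < τ.im) {x : ℂ} (hx : theta1 τ x ≠ 0) :
    DifferentiableOn ℂ (fun w => kron τ w x) {z | theta1 τ z ≠ 0} := by
  intro w hw
  have hd := differentiable_theta1 hτ
  have h1 : DifferentiableAt ℂ (fun w => theta1 τ (w + x)) w :=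
    hd.comp (f := fun w => w + x) (by fun_prop) w
  exact ((h1.const_mul _).div ((hd w).mul_const _) (mul_ne_zero hw hx)).differentiableWithinAt

/-- The Fay identity for the Kronecker function. -/
lemma kron_fay {τ : ℂ} (hτ : 0 < τ.im) {u v x y : ℂ}
    (hu : theta1 τ u ≠ 0) (hv : theta1 τ v ≠ 0) (huv : theta1 τ (u + v) ≠ 0)
    (hx : theta1 τ x ≠ 0) (hy : theta1 τ y ≠ 0) (hxy : theta1 τ (x + y) ≠ 0) :
    kron τ u (x + y) * kron τ v y - kron τ u x * kron τ (u + v) y +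
      kron τ (-v) x * kron τ (u + v) (x + y) = 0 := by
  have h := theta1_three_term hτ u v x y
  have e1 : u + (x + y) = u + x + y := by ring
  have e2 : u + v + (x + y) = u + v + x + y := by ring
  have e3 : -v + x = x - v := by ring
  simp only [kron, theta1_neg, e1, e2, e3]
  field_simp
  linear_combination deriv (theta1 τ) 0 ^ 2 * h

/-- Applying `∂²/∂u∂v` to a Fay type relation. -/
lemma deriv_deriv_of_fay_relation {U : Set ℂ} (hU : IsOpen U) {a b c : ℂ → ℂ}
    (ha : DifferentiableOn ℂ a U) (hb : DifferentiableOn ℂ b U) (hc : DifferentiableOn ℂ c U)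
    (h : ∀ u v, u ∈ U → v ∈ U → -v ∈ U → u + v ∈ U →
      a u * b v - c u * b (u + v) + c (-v) * a (u + v) = 0)
    {u v : ℂ} (hu : u ∈ U) (hv : v ∈ U) (hv' : -v ∈ U) (huv : u + v ∈ U) :
    deriv a u * deriv b v - deriv c u * deriv b (u + v) - deriv c (-v) * deriv a (u + v) =
      c u * deriv (deriv b) (u + v) - c (-v) * deriv (deriv a) (u + v) := by
  have hd {f : ℂ → ℂ} (hf : DifferentiableOn ℂ f U) {z : ℂ} (hz : z ∈ U) :
      HasDerivAt f (deriv f z) z := (hf.differentiableAt (hU.mem_nhds hz)).hasDerivAt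
  have first {u : ℂ} (hu : u ∈ U) (huv : u + v ∈ U) : a u * deriv b v - c u * deriv b (u + v) +
      (-deriv c (-v) * a (u + v) + c (-v) * deriv a (u + v)) = 0 := by
    have h1 := (((hd hb hv).const_mul (a u)).sub
      (((hd hb huv).comp_const_add u v).const_mul (c u))).add
      (((hd hc hv').scomp v (hasDerivAt_neg v)).mul ((hd ha huv).comp_const_add u v))
    have h2 : (fun w => a u * b w - c u * b (u + w) + c (-w) * a (u + w)) =ᶠ[nhds v]
        fun _ => 0 := by
      filter_upwards [hU.mem_nhds hv,
        continuous_neg.continuousAt.preimage_mem_nhds (hU.mem_nhds hv'),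
        (continuous_const_add u).continuousAt.preimage_mem_nhds (hU.mem_nhds huv)] with w h1 h2 h3
      exact h u w hu h1 h2 h3
    have h3 := (h1.congr_of_eventuallyEq h2.symm).unique (hasDerivAt_const v (0 : ℂ))
    simpa using h3
  have h1 := ((((hd ha hu).mul_const (deriv b v))).sub
    ((hd hc hu).mul ((hd (hb.deriv hU) huv).comp_add_const u v))).add
    ((((hd ha huv).comp_add_const u v).const_mul (-deriv c (-v))).add
      (((hd (ha.deriv hU) huv).comp_add_const u v).const_mul (c (-v))))
  have h2 : (fun w => a w * deriv b v - c w * deriv b (w + v) +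
      (-deriv c (-v) * a (w + v) + c (-v) * deriv a (w + v))) =ᶠ[nhds u] fun _ => 0 := by
    filter_upwards [hU.mem_nhds hu,
      (continuous_add_const v).continuousAt.preimage_mem_nhds (hU.mem_nhds huv)] with w h1 h2
    exact first h1 h2
  have h3 := (h1.congr_of_eventuallyEq h2.symm).unique (hasDerivAt_const u (0 : ℂ))
  linear_combination h3

/-- Identity for derivatives of the Kronecker function:
σ'(u,x+y)σ'(v,y) − σ'(u,x)σ'(u+v,y) − σ'(−v,x)σ'(u+v,x+y)
= σ(u,x)σ''(u+v,y) − σ(−v,x)σ''(u+v,x+y). -/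
theorem kron_deriv_identity (τ : ℂ) (hτ : 0 < τ.im) (u v x y : ℂ)
    (hu : u ∉ latticeL τ) (hv : v ∉ latticeL τ) (huv : u + v ∉ latticeL τ)
    (hx : x ∉ latticeL τ) (hy : y ∉ latticeL τ) (hxy : x + y ∉ latticeL τ) :
    kron' τ u (x + y) * kron' τ v y - kron' τ u x * kron' τ (u + v) y -
        kron' τ (-v) x * kron' τ (u + v) (x + y) =
      kron τ u x * kron'' τ (u + v) y - kron τ (-v) x * kron'' τ (u + v) (x + y) := by
  have hne {z : ℂ} (hz : z ∉ latticeL τ) : theta1 τ z ≠ 0 := theta1_ne_zero hτ hz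
  exact deriv_deriv_of_fay_relation (isOpen_compl_theta1_zeros hτ)
    (differentiableOn_kron hτ (hne hxy)) (differentiableOn_kron hτ (hne hy))
    (differentiableOn_kron hτ (hne hx))
    (fun u v hu hv _ huv => kron_fay hτ hu hv huv (hne hx) (hne hy) (hne hxy))
    (hne hu) (hne hv) (hne fun h => hv (neg_mem_latticeL h)) (hne huv)
end
end

section
/- Let τ ∈ ℂ with Im τ > 0, v ∈ ℂ, and let J = J_n(1) ∈ GL_n(ℂ) be the Jordan block of size n with eigenvalue 1. Let Sol = Sol_{J,v} be the space of holomorphic Φ : ℂ → Mat_{n×n}(ℂ) with Φ(z+1) = Φ(z) and Φ(z+τ)·J = −exp(−2πi(z+v+τ))·J·Φ(z). Define Δ : ℂ^{n²} → (ℂ → Mat_{n×n}(ℂ)) by (Δ(u))_{k,l}(z) = e_{n(k−1)+l}ᵗ · (exp(∇N) θ̄_v)(z) · u for 1 ≤ k, l ≤ n, where θ̄_v(z) = θ̄(z + v + (τ+1)/2) and (exp(∇N) f)(z) = Σ_{m≥0} (∇^m f)(z)/m! · N^m. Then Δ(u) ∈ Sol for every u ∈ ℂ^{n²}, and Δ :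 ℂ^{n²} → Sol is a ℂ-linear isomorphism. -/
open Complex Matrix
open scoped TensorProduct

noncomputable section

/-- The space of holomorphic matrix-valued functions with Φ(z+1) = Φ(z) and
Φ(z+τ)·B = c(z)·B·Φ(z). -/
def SolSpace (n : ℕ) (τ : ℂ) (B : Matrix (Fin n) (Fin n) ℂ) (c : ℂ → ℂ) :
    Submodule ℂ (ℂ → Matrix (Fin n) (Fin n) ℂ) where
  carrier := {Φ | (∀ i j, Differentiable ℂ fun z => Φ z i j) ∧
    (∀ z, Φ (z + 1) = Φ z) ∧ (∀ z, Φ (z + τ) * B = c z • (B * Φ z))}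
  add_mem' := by
    rintro Φ Ψ ⟨hd, hp, hq⟩ ⟨gd, gp, gq⟩
    refine ⟨fun i j => ?_, fun z => ?_, fun z => ?_⟩
    · show Differentiable ℂ fun z => Φ z i j + Ψ z i j
      exact (hd i j).add (gd i j)
    · show Φ (z + 1) + Ψ (z + 1) = Φ z + Ψ z
      rw [hp, gp]
    · show (Φ (z + τ) + Ψ (z + τ)) * B = c z • (B * (Φ z + Ψ z))
      rw [add_mul, hq, gq, Matrix.mul_add, smul_add]
  zero_mem' := by
    refine ⟨fun i j => ?_, fun z => rfl, fun z => by simp⟩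
    show Differentiable ℂ fun _ => (0 : ℂ)
    exact differentiable_const 0
  smul_mem' := by
    rintro a Φ ⟨hd, hp, hq⟩
    refine ⟨fun i j => ?_, fun z => ?_, fun z => ?_⟩
    · show Differentiable ℂ fun z => a • Φ z i j
      exact (hd i j).const_smul a
    · show a • Φ (z + 1) = a • Φ z
      rw [hp]
    · show (a • Φ (z + τ)) * B = c z • (B * (a • Φ z))
      rw [Matrix.smul_mul, hq, Matrix.mul_smul, smul_comm]

/-- The blocks of the matrix N: A₀ is the strictly lower-triangular Toeplitz matrix with
entries a_{i−j} = (−1)^{i−j}/(i−j) below the diagonal, and A_k = −a_k·Id for k ≥ 1. -/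
def Ablock (n : ℕ) (k : ℕ) : Matrix (Fin n) (Fin n) ℂ :=
  if k = 0 then
    Matrix.of fun i j : Fin n =>
      if (j : ℕ) < (i : ℕ) then
        (-1 : ℂ) ^ ((i : ℕ) - (j : ℕ)) / ((((i : ℕ) - (j : ℕ) : ℕ)) : ℂ)
      else 0
  else (-((-1 : ℂ) ^ k / (k : ℂ))) • (1 : Matrix (Fin n) (Fin n) ℂ)

/-- The n²×n² block upper-triangular block-Toeplitz matrix N whose (p,q)-block equals
A_{q−p} for q ≥ p and 0 otherwise; rows and columns are indexed by pairs
(block index, index inside the block). -/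
def Nmat (n : ℕ) : Matrix (Fin n × Fin n) (Fin n × Fin n) ℂ :=
  Matrix.of fun pi qj : Fin n × Fin n =>
    if (pi.1 : ℕ) ≤ (qj.1 : ℕ) then Ablock n ((qj.1 : ℕ) - (pi.1 : ℕ)) pi.2 qj.2 else 0

/-- The differential operator ∇ = −(1/(2πi)) d/dz. -/
def nabla (f : ℂ → ℂ) : ℂ → ℂ := fun z => -(1 / (2 * πc * I)) * deriv f z

/-- The Jordan block J_n(1) (ones on the diagonal and the first superdiagonal). -/
def Jord (n : ℕ) : Matrix (Fin n) (Fin n) ℂ :=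
  Matrix.of fun i j : Fin n => if i = j ∨ (j : ℕ) = (i : ℕ) + 1 then 1 else 0

/-- The map Δ : ℂ^{n²} → (ℂ → Mat_{n×n}(ℂ)), (Δ(u))_{k,l}(z) = e_{n(k−1)+l}ᵗ(exp(∇N)θ̄_v)(z)u,
where θ̄_v(z) = θ̄(z+v+(τ+1)/2) and exp(∇N)f = Σ_m (∇^m f/m!)·N^m (a finite sum since N is
nilpotent); the index n(k−1)+l corresponds to the pair (k,l). -/
def DeltaMap (n : ℕ) (τ v : ℂ) (u : Fin n × Fin n → ℂ) : ℂ → Matrix (Fin n) (Fin n) ℂ :=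
  fun z => Matrix.of fun k l : Fin n =>
    ((∑ m ∈ Finset.range (2 * n), ((m.factorial : ℂ))⁻¹ •
        (nabla^[m] (fun w => theta3 τ (w + v + (τ + 1) / 2)) z) • (Nmat n) ^ m).mulVec u)
      (k, l)

theorem intervalIntegral_shift_of_periodic {g : ℂ → ℂ} (hg : Differentiable ℂ g)
    (hp : ∀ z, g (z + 1) = g z) (w : ℂ) :
    ∫ x : ℝ in (0 : ℝ)..1, g (x + w) = ∫ x : ℝ in (0 : ℝ)..1, g x := by
  have hrect := Complex.integral_boundary_rect_eq_zero_of_differentiableOn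
    (fun z => g (z + w.re)) 0 (1 + w.im * I)
    ((hg.comp (differentiable_id.add_const _)).differentiableOn)
  have hper : Function.Periodic (fun x : ℝ => g x) 1 := fun x => by
    simpa using hp x
  have hshift : ∫ x : ℝ in (0 : ℝ)..1, g (x + w.re) = ∫ x : ℝ in (0 : ℝ)..1, g x := by
    have h1 := intervalIntegral.integral_comp_add_right (a := 0) (b := 1)
      (fun x : ℝ => g x) w.re
    have h2 := hper.intervalIntegral_add_eq 0 w.re
    simp only [ofReal_add] at h1
    rw [h1, zero_add, add_comm 1, ← h2, zero_add]
  have hvert : ∀ y : ℝ, g (1 + y * I + w.re) = g (y * I + w.re) := fun y => by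
    rw [← hp (y * I + w.re)]; ring_nf
  have hw : ∀ x : ℝ, (x : ℂ) + w.im * I + w.re = x + w := fun x => by
    conv_rhs => rw [← re_add_im w]
    ring
  simp [hvert, hw, hshift] at hrect
  exact (sub_eq_zero.mp hrect).symm

theorem eq_zero_of_fourier_integrals_eq_zero {f : ℂ → ℂ} (hf : Differentiable ℂ f)
    (hp : ∀ z, f (z + 1) = f z)
    (h0 : ∀ m : ℤ, ∫ x : ℝ in (0 : ℝ)..1, cexp (-(2 * Real.pi * I * m * x)) * f x = 0) :
    f = 0 := by
  have hper : Function.Periodic (fun x : ℝ => f x) 1 := fun x => by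
    simpa using hp x
  have hcont : Continuous (fun x : ℝ => f x) := hf.continuous.comp continuous_ofReal
  let F : C(AddCircle (1 : ℝ), ℂ) := ⟨hper.lift, continuous_coinduced_dom.mpr hcont⟩
  have hF : ∀ x : ℝ, F (x : AddCircle (1 : ℝ)) = f x := fun x => hper.lift_coe x
  have hc : fourierCoeff F = 0 := by
    funext m
    rw [fourierCoeff_eq_intervalIntegral _ _ 0]
    simp only [hF, fourier_coe_apply]
    rw [Pi.zero_apply, zero_add, one_div_one, one_smul, ← h0 m]
    refine intervalIntegral.integral_congr fun x _ => ?_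
    simp
  have hs : Summable (fourierCoeff F) := by rw [hc]; exact summable_zero
  have hreal : ∀ x : ℝ, f x = 0 := fun x => by
    rw [← hF]
    refine (has_pointwise_sum_fourier_series_of_summable hs x).unique ?_
    simp [hc]
  refine (hf.differentiableOn.analyticOnNhd isOpen_univ).eq_of_frequently_eq
    (g := 0) (z₀ := 0) (fun _ _ => analyticAt_const) ?_
  have : Filter.Tendsto (fun k : ℕ => ((1 / ((k : ℝ) + 1) : ℝ) : ℂ)) Filter.atTop
      (nhdsWithin 0 {0}ᶜ) := by
    refine tendsto_nhdsWithin_iff.mpr ⟨?_, .of_forall fun k => ?_⟩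
    · have := (continuous_ofReal.tendsto 0).comp
        (tendsto_one_div_add_atTop_nhds_zero_nat (𝕜 := ℝ))
      simpa [Function.comp_def] using this
    · simp only [Set.mem_compl_iff, Set.mem_singleton_iff, ofReal_eq_zero]
      positivity
  exact this.frequently (.of_forall fun k => hreal _)

theorem eq_zero_of_quasiPeriodic {f : ℂ → ℂ} {τ κ : ℂ} (hκ : κ ≠ 0)
    (hf : Differentiable ℂ f) (hp : ∀ z, f (z + 1) = f z)
    (hq : ∀ z, f (z + τ) = κ * cexp (-(2 * Real.pi * I * z)) * f z)
    (h0 : ∫ x : ℝ in (0 : ℝ)..1, f x = 0) : f = 0 := by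
  set a : ℤ → ℂ := fun m => ∫ x : ℝ in (0 : ℝ)..1, cexp (-(2 * Real.pi * I * m * x)) * f x with ha
  have hrec : ∀ m, a m = κ * cexp (-(2 * Real.pi * I * m * τ)) * a (m + 1) := by
    intro m
    have := intervalIntegral_shift_of_periodic
      (g := fun z => cexp (-(2 * Real.pi * I * m * z)) * f z) (by fun_prop) (fun z => by
        rw [hp]
        congr 1
        rw [Complex.exp_eq_exp_iff_exists_int]
        exact ⟨-m, by push_cast; ring⟩) τ
    simp only [ha]
    rw [← this, ← intervalIntegral.integral_const_mul]
    refine intervalIntegral.integral_congr fun x _ => ?_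
    simp only [hq]
    push_cast
    have : cexp (-(2 * Real.pi * I * m * (x + τ))) * cexp (-(2 * Real.pi * I * x)) =
        cexp (-(2 * Real.pi * I * m * τ)) * cexp (-(2 * Real.pi * I * (m + 1) * x)) := by
      rw [← Complex.exp_add, ← Complex.exp_add]; ring_nf
    linear_combination κ * f x * this
  have ha0 : a 0 = 0 := by simpa [ha] using h0
  refine eq_zero_of_fourier_integrals_eq_zero hf hp fun m => ?_
  change a m = 0
  induction m with
  | zero => exact ha0
  | succ i ih =>
    have := hrec i
    rw [ih, eq_comm] at this
    simpa [hκ] using this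
  | pred i ih => rw [hrec, sub_add_cancel, ih, mul_zero]

theorem integral_jacobiTheta₂ {τ : ℂ} (hτ : 0 < τ.im) :
    ∫ x : ℝ in (0 : ℝ)..1, jacobiTheta₂ x τ = 1 := by
  have hnorm : ∀ m : ℤ, ∀ x : ℝ, ‖jacobiTheta₂_term m x τ‖ = ‖jacobiTheta₂_term m 0 τ‖ := by
    intro m x
    simp [norm_jacobiTheta₂_term]
  have hsum : HasSum (fun m : ℤ => ∫ x : ℝ in (0 : ℝ)..1, jacobiTheta₂_term m x τ)
      (∫ x : ℝ in (0 : ℝ)..1, jacobiTheta₂ x τ) := by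
    refine intervalIntegral.hasSum_integral_of_dominated_convergence
      (fun m _ => ‖jacobiTheta₂_term m 0 τ‖) (fun m => ?_) (fun m => ?_) ?_ ?_ ?_
    · refine Continuous.aestronglyMeasurable ?_
      unfold jacobiTheta₂_term
      fun_prop
    · exact .of_forall fun x _ => (hnorm m x).le
    · exact .of_forall fun x _ => ((summable_jacobiTheta₂_term_iff 0 τ).mpr hτ).norm
    · exact intervalIntegrable_const
    · exact .of_forall fun x _ => hasSum_jacobiTheta₂_term x hτ
  refine hsum.unique ?_
  convert hasSum_single (0 : ℤ) fun m hm => ?_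
  · simp [jacobiTheta₂_term]
  · have hc : (2 * Real.pi * I * m : ℂ) ≠ 0 := by simp [hm, Real.pi_ne_zero]
    simp only [jacobiTheta₂_term, Complex.exp_add]
    rw [intervalIntegral.integral_mul_const, integral_exp_mul_complex hc]
    have : cexp (2 * Real.pi * I * m * (1 : ℝ)) = 1 := by
      rw [Complex.exp_eq_one_iff]; exact ⟨m, by push_cast; ring⟩
    rw [this]; simp

theorem theta3_eq_jacobiTheta₂ (τ z : ℂ) : theta3 τ z = jacobiTheta₂ z τ := by
  unfold theta3 jacobiTheta₂ jacobiTheta₂_term πc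
  refine tsum_congr fun m => ?_
  ring_nf

/-- The factor of automorphy of `z ↦ theta3 τ (z + v + (τ + 1) / 2)` along `τ`. -/
def thetaFactor (τ v z : ℂ) : ℂ := -cexp (-(2 * πc * I) * (z + v + τ))

/-- The translated theta function `z ↦ theta3 τ (z + v + (τ + 1) / 2)`. -/
def thetaShift (τ v z : ℂ) : ℂ := theta3 τ (z + v + (τ + 1) / 2)

theorem differentiable_thetaShift {τ : ℂ} (hτ : 0 < τ.im) (v : ℂ) :
    Differentiable ℂ (thetaShift τ v) := by
  intro z
  unfold thetaShift
  simp only [theta3_eq_jacobiTheta₂]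
  exact (differentiableAt_jacobiTheta₂_fst _ hτ).comp z (by fun_prop)

theorem thetaShift_add_one (τ v z : ℂ) : thetaShift τ v (z + 1) = thetaShift τ v z := by
  simp only [thetaShift, theta3_eq_jacobiTheta₂]
  rw [← jacobiTheta₂_add_left (z + v + (τ + 1) / 2)]
  ring_nf

theorem thetaShift_add_tau (τ v z : ℂ) :
    thetaShift τ v (z + τ) = thetaFactor τ v z * thetaShift τ v z := by
  simp only [thetaShift, thetaFactor, theta3_eq_jacobiTheta₂, πc]
  rw [show z + τ + v + (τ + 1) / 2 = z + v + (τ + 1) / 2 + τ by ring, jacobiTheta₂_add_left',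
    show -(Real.pi : ℂ) * I * (τ + 2 * (z + v + (τ + 1) / 2)) =
      -(2 * Real.pi * I) * (z + v + τ) - Real.pi * I by ring, Complex.exp_sub_pi_mul_I]

theorem exists_thetaShift_ne_zero {τ : ℂ} (hτ : 0 < τ.im) (v : ℂ) :
    ∃ z, thetaShift τ v z ≠ 0 := by
  by_contra! h
  have hint := integral_jacobiTheta₂ hτ
  have : ∀ z, jacobiTheta₂ z τ = 0 := fun z => by
    have := h (z - v - (τ + 1) / 2)
    rw [thetaShift, theta3_eq_jacobiTheta₂] at this
    rwa [show z - v - (τ + 1) / 2 + v + (τ + 1) / 2 = z by ring] at this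
  simp [this] at hint

theorem thetaFactor_eq (τ v z : ℂ) :
    thetaFactor τ v z =
      -cexp (-(2 * Real.pi * I * (v + τ))) * cexp (-(2 * Real.pi * I * z)) := by
  rw [thetaFactor, πc, neg_mul, neg_mul, ← Complex.exp_add]
  ring_nf

theorem exists_eq_smul_thetaShift {τ : ℂ} (hτ : 0 < τ.im) (v : ℂ) {f : ℂ → ℂ}
    (hf : Differentiable ℂ f) (hp : ∀ z, f (z + 1) = f z)
    (hq : ∀ z, f (z + τ) = thetaFactor τ v z * f z) :
    ∃ a : ℂ, ∀ z, f z = a * thetaShift τ v z := by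
  have hκ : -cexp (-(2 * Real.pi * I * (v + τ))) ≠ 0 := neg_ne_zero.mpr (Complex.exp_ne_zero _)
  have hd := differentiable_thetaShift hτ v
  have hθ : ∫ x : ℝ in (0 : ℝ)..1, thetaShift τ v x ≠ 0 := by
    intro h0
    obtain ⟨z, hz⟩ := exists_thetaShift_ne_zero hτ v
    refine hz (congrFun (eq_zero_of_quasiPeriodic (τ := τ) hκ hd (thetaShift_add_one τ v)
      (fun w => ?_) h0) z)
    rw [thetaShift_add_tau, thetaFactor_eq]
  set a := (∫ x : ℝ in (0 : ℝ)..1, f x) / ∫ x : ℝ in (0 : ℝ)..1, thetaShift τ v x with ha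
  have hzero := eq_zero_of_quasiPeriodic (f := fun z => f z - a * thetaShift τ v z) (τ := τ) hκ
    (hf.sub (hd.const_mul a)) (fun z => by simp only [hp, thetaShift_add_one])
    (fun z => by
      rw [hq, thetaShift_add_tau, thetaFactor_eq]
      ring) (by
      rw [intervalIntegral.integral_sub, intervalIntegral.integral_const_mul, ha,
        div_mul_cancel₀ _ hθ, sub_self]
      · exact (hf.continuous.comp continuous_ofReal).intervalIntegrable _ _
      · exact ((hd.continuous.comp continuous_ofReal).const_mul a).intervalIntegrable _ _)
  exact ⟨a, fun z => sub_eq_zero.mp (congrFun hzero z)⟩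

section NilpotentLog

open Polynomial

/-- The truncation of the Mercator series of `log (1 + X)` below degree `n`. -/
def logTrunc (n : ℕ) : ℂ[X] :=
  ∑ k ∈ Finset.range n, C (-((-1 : ℂ) ^ k / (k : ℂ))) * X ^ k

/-- The exponential of the truncated logarithm, truncated below degree `n`. -/
def expLogTrunc (n : ℕ) : ℂ[X] :=
  ∑ i ∈ Finset.range n, C ((i.factorial : ℂ)⁻¹) * logTrunc n ^ i

theorem X_dvd_logTrunc (n : ℕ) : X ∣ logTrunc n := by
  refine Finset.dvd_sum fun k _ => ?_
  rcases k with _ | k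
  · simp
  · exact dvd_mul_of_dvd_right (dvd_pow_self X k.succ_ne_zero) _

theorem derivative_logTrunc_mul (n : ℕ) :
    derivative (logTrunc (n + 1)) * (1 + X) = 1 - (-X) ^ n := by
  have h : derivative (logTrunc (n + 1)) = ∑ k ∈ Finset.range n, (-X : ℂ[X]) ^ k := by
    rw [logTrunc, derivative_sum, Finset.sum_range_succ']
    simp only [Nat.cast_zero, div_zero, neg_zero, C_0, zero_mul, derivative_zero, add_zero]
    refine Finset.sum_congr rfl fun k _ => ?_
    rw [derivative_C_mul, derivative_X_pow, neg_pow (X : ℂ[X]), ← mul_assoc, ← C_mul,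
      Nat.add_sub_cancel]
    congr 1
    have : ((k : ℂ) + 1) ≠ 0 := Nat.cast_add_one_ne_zero k
    rw [show (-1 : ℂ[X]) ^ k = C ((-1) ^ k) by simp]
    congr 1
    push_cast
    field_simp
    ring
  rw [h]
  linear_combination geom_sum_mul_neg (-X : ℂ[X]) n

theorem X_pow_dvd_derivative_expLogTrunc (n : ℕ) :
    X ^ n ∣ derivative (expLogTrunc (n + 1)) * (1 + X) - expLogTrunc (n + 1) := by
  have hd : derivative (expLogTrunc (n + 1)) = derivative (logTrunc (n + 1)) *
      (expLogTrunc (n + 1) - C ((n.factorial : ℂ)⁻¹) * logTrunc (n + 1) ^ n) := by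
    have h1 : expLogTrunc (n + 1) - C ((n.factorial : ℂ)⁻¹) * logTrunc (n + 1) ^ n =
        ∑ i ∈ Finset.range n, C ((i.factorial : ℂ)⁻¹) * logTrunc (n + 1) ^ i := by
      rw [expLogTrunc, Finset.sum_range_succ, add_sub_cancel_right]
    rw [h1, expLogTrunc, derivative_sum, Finset.sum_range_succ', Finset.mul_sum]
    simp only [derivative_C_mul, derivative_pow, pow_zero, derivative_one, mul_zero, add_zero]
    refine Finset.sum_congr rfl fun i _ => ?_
    have : C (((i + 1).factorial : ℂ)⁻¹) * C (((i + 1 : ℕ) : ℂ)) = C ((i.factorial : ℂ)⁻¹) := by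
      rw [← C_mul, Nat.factorial_succ]
      congr 1
      have : ((i : ℂ) + 1) ≠ 0 := Nat.cast_add_one_ne_zero i
      push_cast
      field_simp
    rw [← this, Nat.add_sub_cancel]
    ring
  have hX : (X : ℂ[X]) ^ n ∣ logTrunc (n + 1) ^ n := pow_dvd_pow_of_dvd (X_dvd_logTrunc _) n
  have : derivative (expLogTrunc (n + 1)) * (1 + X) - expLogTrunc (n + 1) =
      -(C ((n.factorial : ℂ)⁻¹) * (1 - (-X) ^ n)) * logTrunc (n + 1) ^ n +
        (-((-1) ^ n * expLogTrunc (n + 1))) * X ^ n := by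
    rw [hd]
    have := derivative_logTrunc_mul n
    rw [neg_pow] at this ⊢
    linear_combination (expLogTrunc (n + 1) -
      C ((n.factorial : ℂ)⁻¹) * logTrunc (n + 1) ^ n) * this
  rw [this]
  exact dvd_add (dvd_mul_of_dvd_right hX _) (dvd_mul_left _ _)

theorem X_pow_dvd_expLogTrunc_sub (n : ℕ) : X ^ n ∣ expLogTrunc n - (1 + X) := by
  rcases n with _ | n
  · simp
  have hrec : ∀ k < n, (expLogTrunc (n + 1)).coeff (k + 1) * (k + 1) =
      (1 - k) * (expLogTrunc (n + 1)).coeff k := by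
    intro k hk
    have h := (X_pow_dvd_iff.mp (X_pow_dvd_derivative_expLogTrunc n)) k hk
    rw [mul_add, mul_one, coeff_sub, coeff_add, coeff_derivative] at h
    rcases k with _ | k
    · simp at h ⊢
      linear_combination h
    · rw [coeff_mul_X, coeff_derivative] at h
      push_cast at h ⊢
      linear_combination h
  have hzero : (expLogTrunc (n + 1)).coeff 0 = 1 := by
    obtain ⟨q, hq⟩ := X_dvd_logTrunc (n + 1)
    have : (logTrunc (n + 1)).coeff 0 = 0 := by rw [hq]; simp
    rw [coeff_zero_eq_eval_zero] at this ⊢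
    rw [expLogTrunc, eval_finsetSum, Finset.sum_range_succ']
    simp [this]
  have htwo : ∀ k, k + 2 < n + 1 → (expLogTrunc (n + 1)).coeff (k + 2) = 0 := by
    intro k
    induction k with
    | zero =>
      intro hk
      have := hrec 1 (by omega)
      have h2 : ((1 : ℕ) : ℂ) + 1 ≠ 0 := Nat.cast_add_one_ne_zero 1
      simpa [h2] using this
    | succ k ih =>
      intro hk
      have := hrec (k + 2) (by omega)
      rw [ih (by omega), mul_zero] at this
      exact (mul_eq_zero.mp this).resolve_right (Nat.cast_add_one_ne_zero (k + 2))
  rw [X_pow_dvd_iff]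
  rintro (_ | _ | k) hk
  · simp [hzero]
  · have := hrec 0 (by omega)
    simp [hzero] at this
    simp [this, coeff_one]
  · rw [coeff_sub, htwo k hk]
    simp [coeff_one, coeff_X]

theorem IsNilpotent.exp_logTrunc {A : Type*} [Ring A] [Algebra ℂ A] [Module ℚ A]
    {u : A} {n : ℕ} (hu : u ^ n = 0) :
    aeval u (logTrunc n) ^ n = 0 ∧ IsNilpotent.exp (aeval u (logTrunc n)) = 1 + u := by
  have hpow : aeval u (logTrunc n) ^ n = 0 := by
    obtain ⟨q, hq⟩ := pow_dvd_pow_of_dvd (X_dvd_logTrunc n) n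
    rw [← map_pow, hq, map_mul, map_pow, aeval_X, hu, zero_mul]
  refine ⟨hpow, ?_⟩
  obtain ⟨q, hq⟩ := X_pow_dvd_expLogTrunc_sub n
  have h := congrArg (aeval u) hq
  rw [map_mul, map_pow, aeval_X, hu, zero_mul, map_sub, sub_eq_zero] at h
  rw [IsNilpotent.exp_eq_sum hpow]
  simp only [map_add, map_one, aeval_X] at h
  rw [← h, expLogTrunc, map_sum]
  refine Finset.sum_congr rfl fun i _ => ?_
  rw [map_mul, aeval_C, map_pow, ← Algebra.smul_def]
  exact inv_natCast_smul_eq ℚ ℂ _ _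

end NilpotentLog

/-- The nilpotent Jordan block. -/
def jordShift (n : ℕ) : Matrix (Fin n) (Fin n) ℂ :=
  Matrix.of fun i j : Fin n => if (j : ℕ) = (i : ℕ) + 1 then 1 else 0

theorem jordShift_pow_apply (n k : ℕ) (i j : Fin n) :
    (jordShift n ^ k) i j = if (j : ℕ) = (i : ℕ) + k then 1 else 0 := by
  induction k generalizing i j with
  | zero =>
    simp [Matrix.one_apply, Fin.ext_iff, eq_comm]
  | succ k ih =>
    rw [pow_succ', Matrix.mul_apply]
    simp only [ih]
    simp only [jordShift, Matrix.of_apply, ite_mul, one_mul, zero_mul]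
    by_cases h : (i : ℕ) + 1 < n
    · rw [Finset.sum_eq_single (⟨i + 1, h⟩ : Fin n)]
      · simp [add_assoc, add_comm 1 k]
      · intro b _ hb
        rw [if_neg]
        exact fun h' => hb (Fin.ext h')
      · simp
    · rw [if_neg (by omega), Finset.sum_eq_zero]
      intro b _
      rw [if_neg (by omega)]

theorem jordShift_pow_self (n : ℕ) : jordShift n ^ n = 0 := by
  ext i j
  rw [jordShift_pow_apply, if_neg (by omega), Matrix.zero_apply]

theorem Jord_eq (n : ℕ) : Jord n = 1 + jordShift n := by
  ext i j
  simp only [Jord, jordShift, Matrix.of_apply, Matrix.add_apply, Matrix.one_apply]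
  by_cases h : i = j
  · subst h; simp
  · simp [h]

/-- The logarithm of the Jordan block with eigenvalue `1`. -/
def logJord (n : ℕ) : Matrix (Fin n) (Fin n) ℂ := Polynomial.aeval (jordShift n) (logTrunc n)

theorem logJord_pow_self (n : ℕ) : logJord n ^ n = 0 :=
  (IsNilpotent.exp_logTrunc (jordShift_pow_self n)).1

theorem exp_logJord (n : ℕ) : IsNilpotent.exp (logJord n) = Jord n := by
  rw [Jord_eq]
  exact (IsNilpotent.exp_logTrunc (jordShift_pow_self n)).2

theorem logJord_apply (n : ℕ) (i j : Fin n) :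
    logJord n i j =
      if (i : ℕ) < (j : ℕ) then
        -((-1 : ℂ) ^ ((j : ℕ) - (i : ℕ)) / (((j : ℕ) - (i : ℕ) : ℕ) : ℂ)) else 0 := by
  rw [logJord, logTrunc, map_sum, Matrix.sum_apply]
  simp only [map_mul, Polynomial.aeval_C, map_pow, Polynomial.aeval_X, ← Algebra.smul_def,
    Matrix.smul_apply, jordShift_pow_apply, smul_eq_mul, mul_ite, mul_one, mul_zero]
  split_ifs with h
  · rw [Finset.sum_eq_single ((j : ℕ) - (i : ℕ))]
    · rw [if_pos (by omega)]
    · intro b _ hb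
      rw [if_neg (by omega)]
    · intro hb
      exact absurd (Finset.mem_range.mpr (by omega)) hb
  · refine Finset.sum_eq_zero fun k _ => ?_
    split_ifs with hk
    · obtain rfl : k = 0 := by omega
      simp
    · rfl

/-- The commutator with the logarithm of the Jordan block. -/
def adLogJord (n : ℕ) : Module.End ℂ (Matrix (Fin n) (Fin n) ℂ) :=
  LinearMap.mulLeft ℂ (logJord n) + LinearMap.mulRight ℂ (-logJord n)

theorem commute_mulLeft_mulRight_logJord (n : ℕ) :
    Commute (LinearMap.mulLeft ℂ (logJord n)) (LinearMap.mulRight ℂ (-logJord n)) :=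
  LinearMap.commute_mulLeft_right _ _

theorem mulLeft_logJord_pow (n : ℕ) : LinearMap.mulLeft ℂ (logJord n) ^ n = 0 := by
  rw [LinearMap.pow_mulLeft, logJord_pow_self, LinearMap.mulLeft_zero_eq_zero]

theorem mulRight_neg_logJord_pow (n : ℕ) : LinearMap.mulRight ℂ (-logJord n) ^ n = 0 := by
  rw [LinearMap.pow_mulRight, neg_pow, logJord_pow_self, mul_zero,
    LinearMap.mulRight_zero_eq_zero]

theorem adLogJord_pow (n : ℕ) : adLogJord n ^ (2 * n) = 0 :=
  (commute_mulLeft_mulRight_logJord n).add_pow_eq_zero_of_add_le_succ_of_pow_eq_zero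
    (mulLeft_logJord_pow n) (mulRight_neg_logJord_pow n) (by omega)

theorem exp_adLogJord_apply (n : ℕ) (Y : Matrix (Fin n) (Fin n) ℂ) :
    IsNilpotent.exp (adLogJord n) Y = Jord n * Y * IsNilpotent.exp (-logJord n) := by
  have hneg : (-logJord n) ^ n = 0 := by rw [neg_pow, logJord_pow_self, mul_zero]
  rw [adLogJord, IsNilpotent.exp_add_of_commute (commute_mulLeft_mulRight_logJord n)
    ⟨n, mulLeft_logJord_pow n⟩ ⟨n, mulRight_neg_logJord_pow n⟩, ← exp_logJord,
    IsNilpotent.exp_eq_sum (mulLeft_logJord_pow n),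
    IsNilpotent.exp_eq_sum (mulRight_neg_logJord_pow n),
    IsNilpotent.exp_eq_sum (logJord_pow_self n), IsNilpotent.exp_eq_sum hneg]
  simp only [LinearMap.pow_mulLeft, LinearMap.pow_mulRight, Module.End.mul_apply,
    LinearMap.sum_apply, LinearMap.smul_apply, LinearMap.mulLeft_apply, LinearMap.mulRight_apply,
    Finset.sum_mul, Finset.mul_sum, smul_mul_assoc, mul_smul_comm, mul_assoc]

theorem exp_neg_logJord_mul_Jord (n : ℕ) : IsNilpotent.exp (-logJord n) * Jord n = 1 := by
  rw [← exp_logJord]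
  exact IsNilpotent.exp_neg_mul_exp_self ⟨n, logJord_pow_self n⟩

theorem Jord_mul_exp_neg_logJord (n : ℕ) : Jord n * IsNilpotent.exp (-logJord n) = 1 := by
  rw [← exp_logJord]
  exact IsNilpotent.exp_mul_exp_neg_self ⟨n, logJord_pow_self n⟩

theorem mul_Jord_eq_iff (n : ℕ) (a : ℂ) (X Y : Matrix (Fin n) (Fin n) ℂ) :
    X * Jord n = a • (Jord n * Y) ↔ X = a • IsNilpotent.exp (adLogJord n) Y := by
  rw [exp_adLogJord_apply]
  constructor
  · intro h
    rw [← smul_mul_assoc, ← h, mul_assoc, Jord_mul_exp_neg_logJord, mul_one]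
  · rintro rfl
    rw [smul_mul_assoc, mul_assoc, exp_neg_logJord_mul_Jord, mul_one]

/-- Vectors indexed by pairs, seen as matrices. -/
def vecToMatrix (n : ℕ) : (Fin n × Fin n → ℂ) ≃ₗ[ℂ] Matrix (Fin n) (Fin n) ℂ where
  toFun u := Matrix.of fun k l => u (k, l)
  invFun X p := X p.1 p.2
  map_add' _ _ := rfl
  map_smul' _ _ := rfl
  left_inv _ := rfl
  right_inv _ := rfl

theorem vecToMatrix_apply (n : ℕ) (u : Fin n × Fin n → ℂ) (k l : Fin n) :
    vecToMatrix n u k l = u (k, l) := rfl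

theorem Nmat_apply (n : ℕ) (p i q j : Fin n) :
    Nmat n (p, i) (q, j) =
      (if i = j then logJord n p q else 0) - if p = q then logJord n j i else 0 := by
  simp only [Nmat, Matrix.of_apply, Ablock, logJord_apply]
  rcases lt_trichotomy (p : ℕ) (q : ℕ) with h | h | h
  · have h1 : p ≠ q := fun e => h.ne (congrArg Fin.val e)
    rw [if_pos h.le, if_neg (by omega), if_neg h1, if_pos h]
    simp [Matrix.one_apply]
  · obtain rfl := Fin.ext h
    by_cases hij : j < i
    · simp [hij, hij.ne']
    · simp [hij]
  · have h1 : p ≠ q := fun e => h.ne' (congrArg Fin.val e)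
    simp [h1, h.not_ge, h.not_gt]

theorem vecToMatrix_Nmat_mulVec (n : ℕ) (u : Fin n × Fin n → ℂ) :
    vecToMatrix n ((Nmat n).mulVec u) = adLogJord n (vecToMatrix n u) := by
  ext p i
  simp [vecToMatrix_apply, adLogJord, Matrix.mulVec, dotProduct, Fintype.sum_prod_type, Nmat_apply,
    sub_mul, Finset.sum_sub_distrib, Matrix.mul_apply, ← sub_eq_add_neg, mul_comm]

theorem vecToMatrix_Nmat_pow_mulVec (n m : ℕ) (u : Fin n × Fin n → ℂ) :
    vecToMatrix n ((Nmat n ^ m).mulVec u) = (adLogJord n ^ m) (vecToMatrix n u) := by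
  induction m with
  | zero => simp
  | succ m ih =>
    rw [pow_succ', ← Matrix.mulVec_mulVec, vecToMatrix_Nmat_mulVec, ih, pow_succ',
      Module.End.mul_apply]

theorem differentiable_nabla {f : ℂ → ℂ} (hf : Differentiable ℂ f) :
    Differentiable ℂ (nabla f) := by
  have : Differentiable ℂ (deriv f) :=
    differentiableOn_univ.mp (hf.differentiableOn.deriv isOpen_univ)
  exact this.const_mul _

theorem differentiable_nabla_iterate {f : ℂ → ℂ} (hf : Differentiable ℂ f) (m : ℕ) :
    Differentiable ℂ (nabla^[m] f) := by
  induction m with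
  | zero => exact hf
  | succ m ih =>
    rw [Function.iterate_succ_apply']
    exact differentiable_nabla ih

theorem nabla_iterate_add_const {f : ℂ → ℂ} {a : ℂ} (hf : ∀ z, f (z + a) = f z) (m : ℕ) (z : ℂ) :
    nabla^[m] f (z + a) = nabla^[m] f z := by
  induction m generalizing z with
  | zero => exact hf z
  | succ m ih =>
    rw [Function.iterate_succ_apply', nabla, nabla, ← deriv_comp_add_const]
    simp only [ih]

theorem hasDerivAt_thetaFactor (τ v z : ℂ) :
    HasDerivAt (thetaFactor τ v) (-(2 * πc * I) * thetaFactor τ v z) z := by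
  have h : HasDerivAt (fun z => -(2 * πc * I) * (z + v + τ)) (-(2 * πc * I) * 1) z :=
    (((hasDerivAt_id z).add_const v).add_const τ).const_mul _
  refine h.cexp.neg.congr_deriv ?_
  rw [thetaFactor]
  ring

theorem nabla_add_tau {g h : ℂ → ℂ} {τ v : ℂ} (hh : Differentiable ℂ h)
    (hgh : ∀ z, g (z + τ) = thetaFactor τ v z * h z) (z : ℂ) :
    nabla g (z + τ) = thetaFactor τ v z * (h z + nabla h z) := by
  have hd : deriv g (z + τ) =
      -(2 * πc * I) * thetaFactor τ v z * h z + thetaFactor τ v z * deriv h z := by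
    rw [← deriv_comp_add_const]
    simp only [hgh]
    exact ((hasDerivAt_thetaFactor τ v z).mul (hh z).hasDerivAt).deriv
  have hπ : πc ≠ 0 := ofReal_ne_zero.mpr Real.pi_ne_zero
  rw [nabla, nabla, hd]
  field_simp [I_ne_zero]
  ring

theorem nabla_iterate_thetaShift_add_tau {τ : ℂ} (hτ : 0 < τ.im) (v : ℂ) (m : ℕ) (z : ℂ) :
    nabla^[m] (thetaShift τ v) (z + τ) = thetaFactor τ v z *
      ∑ i ∈ Finset.range (m + 1), (m.choose i : ℂ) * nabla^[i] (thetaShift τ v) z := by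
  have hd := differentiable_nabla_iterate (differentiable_thetaShift hτ v)
  induction m generalizing z with
  | zero => simpa using thetaShift_add_tau τ v z
  | succ m ih =>
    rw [Function.iterate_succ_apply', nabla_add_tau (by fun_prop) ih,
      Finset.sum_choose_succ_mul (fun i _ => nabla^[i] (thetaShift τ v) z)]
    congr 2
    rw [nabla, deriv_fun_sum fun i _ => ((hd i).const_mul _).differentiableAt, Finset.mul_sum]
    refine Finset.sum_congr rfl fun i _ => ?_
    rw [deriv_const_mul _ (hd i z), Function.iterate_succ_apply', nabla]
    ring

theorem sum_binomial_smul_pow {A : Type*} [Ring A] [Algebra ℂ A] [Module ℚ A] {D : A} {M : ℕ}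
    (hD : D ^ M = 0) (x : ℕ → ℂ) :
    ∑ m ∈ Finset.range M, ((m.factorial : ℂ)⁻¹ *
        ∑ i ∈ Finset.range (m + 1), (m.choose i : ℂ) * x i) • D ^ m =
      IsNilpotent.exp D * ∑ m ∈ Finset.range M, ((m.factorial : ℂ)⁻¹ * x m) • D ^ m := by
  have hexp : IsNilpotent.exp D = ∑ k ∈ Finset.range M, (k.factorial : ℂ)⁻¹ • D ^ k := by
    rw [IsNilpotent.exp_eq_sum hD]
    exact Finset.sum_congr rfl fun i _ => inv_natCast_smul_eq ℚ ℂ _ _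
  set g : ℕ → ℕ → A := fun i k =>
    ((i.factorial : ℂ)⁻¹ * x i * (k.factorial : ℂ)⁻¹) • D ^ (k + i) with hg
  calc _ = ∑ m ∈ Finset.range M, ∑ i ∈ Finset.range (m + 1), g i (m - i) := by
        refine Finset.sum_congr rfl fun m _ => ?_
        rw [Finset.mul_sum, Finset.sum_smul]
        refine Finset.sum_congr rfl fun i hi => ?_
        have him : i ≤ m := Nat.lt_succ_iff.mp (Finset.mem_range.mp hi)
        simp only [hg]
        rw [Nat.sub_add_cancel him, Nat.cast_choose ℂ him]
        congr 1
        have := Nat.cast_ne_zero (R := ℂ).mpr m.factorial_ne_zero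
        field_simp
    _ = ∑ i ∈ Finset.range M, ∑ k ∈ Finset.range (M - i), g i k := Finset.sum_range_diag_flip M g
    _ = ∑ i ∈ Finset.range M, ∑ k ∈ Finset.range M, g i k := by
        refine Finset.sum_congr rfl fun i _ => ?_
        refine Finset.sum_subset (Finset.range_mono (Nat.sub_le M i)) fun k _ hk => ?_
        rw [Finset.mem_range, not_lt] at hk
        simp only [hg]
        rw [pow_eq_zero_of_le (by omega) hD, smul_zero]
    _ = _ := by
        rw [hexp, Finset.sum_mul_sum, Finset.sum_comm]
        refine Finset.sum_congr rfl fun k _ => Finset.sum_congr rfl fun i _ => ?_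
        rw [smul_mul_smul_comm, ← pow_add]
        simp only [hg]
        congr 1
        ring

/-- The value at `z` of `exp (∇ ⊗ ad (log J))` applied to the translated theta function. -/
def expNabla (n : ℕ) (τ v z : ℂ) : Module.End ℂ (Matrix (Fin n) (Fin n) ℂ) :=
  ∑ m ∈ Finset.range (2 * n),
    ((m.factorial : ℂ)⁻¹ * nabla^[m] (thetaShift τ v) z) • adLogJord n ^ m

theorem DeltaMap_eq_expNabla (n : ℕ) (τ v : ℂ) (u : Fin n × Fin n → ℂ) :
    DeltaMap n τ v u = fun z => expNabla n τ v z (vecToMatrix n u) := by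
  funext z
  change vecToMatrix n (Matrix.mulVec _ u) = _
  rw [Matrix.sum_mulVec, map_sum, expNabla, LinearMap.sum_apply]
  refine Finset.sum_congr rfl fun m _ => ?_
  rw [smul_smul, Matrix.smul_mulVec, map_smul, vecToMatrix_Nmat_pow_mulVec, LinearMap.smul_apply]
  rfl

theorem expNabla_add_tau (n : ℕ) {τ : ℂ} (hτ : 0 < τ.im) (v z : ℂ) :
    expNabla n τ v (z + τ) =
      thetaFactor τ v z • (IsNilpotent.exp (adLogJord n) * expNabla n τ v z) := by
  rw [expNabla, expNabla, ← sum_binomial_smul_pow (adLogJord_pow n), Finset.smul_sum]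
  refine Finset.sum_congr rfl fun m _ => ?_
  rw [nabla_iterate_thetaShift_add_tau hτ, smul_smul]
  congr 1
  ring

theorem pow_adLogJord_expNabla {n : ℕ} (hn : 1 ≤ n) (τ v z : ℂ) {k : ℕ}
    {X : Matrix (Fin n) (Fin n) ℂ} (hX : (adLogJord n ^ (k + 1)) X = 0) :
    (adLogJord n ^ k) (expNabla n τ v z X) = thetaShift τ v z • (adLogJord n ^ k) X := by
  rw [expNabla, LinearMap.sum_apply, map_sum, Finset.sum_eq_single 0]
  · simp
  · intro m _ hm
    obtain ⟨m, rfl⟩ := Nat.exists_eq_succ_of_ne_zero hm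
    rw [LinearMap.smul_apply, map_smul, ← Module.End.mul_apply, ← pow_add,
      show k + m.succ = m + (k + 1) by omega, pow_add, Module.End.mul_apply, hX, map_zero,
      smul_zero]
  · intro h
    exact absurd (Finset.mem_range.mpr (by omega)) h

theorem differentiable_linearMap_apply {n : ℕ}
    (T : Module.End ℂ (Matrix (Fin n) (Fin n) ℂ)) {Φ : ℂ → Matrix (Fin n) (Fin n) ℂ}
    (hΦ : ∀ i j, Differentiable ℂ fun z => Φ z i j) (i j : Fin n) :
    Differentiable ℂ fun z => T (Φ z) i j := by
  have h : ∀ z, T (Φ z) i j = ∑ k, ∑ l, Φ z k l * T (Matrix.single k l 1) i j := fun z => by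
    conv_lhs => rw [Matrix.matrix_eq_sum_single (Φ z)]
    simp only [map_sum, Matrix.sum_apply]
    refine Finset.sum_congr rfl fun k _ => Finset.sum_congr rfl fun l _ => ?_
    rw [← mul_one (Φ z k l), ← smul_eq_mul, ← Matrix.smul_single, map_smul]
    simp
  simp only [h]
  fun_prop

theorem mem_SolSpace_thetaFactor_iff {n : ℕ} {τ v : ℂ} {Φ : ℂ → Matrix (Fin n) (Fin n) ℂ} :
    Φ ∈ SolSpace n τ (Jord n) (thetaFactor τ v) ↔
      (∀ i j, Differentiable ℂ fun z => Φ z i j) ∧ (∀ z, Φ (z + 1) = Φ z) ∧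
        ∀ z, Φ (z + τ) = thetaFactor τ v z • IsNilpotent.exp (adLogJord n) (Φ z) := by
  simp only [← mul_Jord_eq_iff]
  rfl

theorem expNabla_mem_SolSpace {n : ℕ} {τ : ℂ} (hτ : 0 < τ.im) (v : ℂ)
    (X : Matrix (Fin n) (Fin n) ℂ) :
    (fun z => expNabla n τ v z X) ∈ SolSpace n τ (Jord n) (thetaFactor τ v) := by
  refine mem_SolSpace_thetaFactor_iff.mpr ⟨fun i j => ?_, fun z => ?_, fun z => ?_⟩
  · simp only [expNabla, LinearMap.sum_apply, Matrix.sum_apply, LinearMap.smul_apply,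
      Matrix.smul_apply, smul_eq_mul]
    have hd := differentiable_nabla_iterate (differentiable_thetaShift hτ v)
    fun_prop
  · simp only [expNabla, nabla_iterate_add_const (thetaShift_add_one τ v)]
  · simp only [expNabla_add_tau n hτ, LinearMap.smul_apply, Module.End.mul_apply]

theorem expNabla_injective {n : ℕ} (hn : 1 ≤ n) {τ : ℂ} (hτ : 0 < τ.im) (v : ℂ)
    {X : Matrix (Fin n) (Fin n) ℂ} (h0 : ∀ z, expNabla n τ v z X = 0) : X = 0 := by
  obtain ⟨z, hz⟩ := exists_thetaShift_ne_zero hτ v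
  have key : ∀ k, (adLogJord n ^ k) X = 0 → X = 0 := by
    intro k
    induction k with
    | zero => exact id
    | succ k ih =>
      intro hX
      have := pow_adLogJord_expNabla hn τ v z hX
      rw [h0, map_zero, eq_comm, smul_eq_zero] at this
      exact ih (this.resolve_left hz)
  exact key (2 * n) (by rw [adLogJord_pow, LinearMap.zero_apply])

theorem exp_adLogJord_apply_of_eq_zero {n : ℕ} {Y : Matrix (Fin n) (Fin n) ℂ}
    (hY : adLogJord n Y = 0) : IsNilpotent.exp (adLogJord n) Y = Y := by
  have h : adLogJord n ^ (2 * n + 1) = 0 := by rw [pow_succ, adLogJord_pow, zero_mul]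
  rw [IsNilpotent.exp_eq_sum h, LinearMap.sum_apply, Finset.sum_eq_single 0]
  · simp
  · intro m _ hm
    obtain ⟨m, rfl⟩ := Nat.exists_eq_succ_of_ne_zero hm
    rw [LinearMap.smul_apply, pow_succ, Module.End.mul_apply, hY, map_zero, smul_zero]
  · simp

theorem exp_adLogJord_pow_comm (n k : ℕ) (Y : Matrix (Fin n) (Fin n) ℂ) :
    (adLogJord n ^ k) (IsNilpotent.exp (adLogJord n) Y) =
      IsNilpotent.exp (adLogJord n) ((adLogJord n ^ k) Y) := by
  rw [IsNilpotent.exp_eq_sum (adLogJord_pow n), ← Module.End.mul_apply, ← Module.End.mul_apply]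
  congr 1
  rw [Finset.mul_sum, Finset.sum_mul]
  refine Finset.sum_congr rfl fun i _ => ?_
  rw [mul_smul_comm, smul_mul_assoc, ← pow_add, ← pow_add, add_comm]

theorem exists_eq_expNabla {n : ℕ} (hn : 1 ≤ n) {τ : ℂ} (hτ : 0 < τ.im) (v : ℂ)
    {Φ : ℂ → Matrix (Fin n) (Fin n) ℂ} (hΦ : Φ ∈ SolSpace n τ (Jord n) (thetaFactor τ v)) :
    ∃ X, ∀ z, Φ z = expNabla n τ v z X := by
  obtain ⟨z₀, hz₀⟩ := exists_thetaShift_ne_zero hτ v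
  have key : ∀ k, ∀ Φ ∈ SolSpace n τ (Jord n) (thetaFactor τ v),
      (∀ z, (adLogJord n ^ k) (Φ z) = 0) → ∃ X, ∀ z, Φ z = expNabla n τ v z X := by
    intro k
    induction k with
    | zero => exact fun Φ _ h => ⟨0, fun z => by rw [map_zero]; exact h z⟩
    | succ k ih =>
      intro Φ hΦ hk
      obtain ⟨hd, hp, hq⟩ := mem_SolSpace_thetaFactor_iff.mp hΦ
      have hχ : ∀ z, (adLogJord n ^ k) (Φ (z + τ)) =
          thetaFactor τ v z • (adLogJord n ^ k) (Φ z) := fun z => by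
        rw [hq, map_smul, exp_adLogJord_pow_comm, exp_adLogJord_apply_of_eq_zero]
        rw [← Module.End.mul_apply, ← pow_succ']
        exact hk z
      have hscalar : ∀ i j, ∃ a : ℂ, ∀ z,
          (adLogJord n ^ k) (Φ z) i j = a * thetaShift τ v z := fun i j =>
        exists_eq_smul_thetaShift hτ v (differentiable_linearMap_apply _ hd i j)
          (fun z => by rw [hp]) (fun z => by rw [hχ]; rfl)
      set X₀ := (thetaShift τ v z₀)⁻¹ • Φ z₀ with hX₀
      have hlead : ∀ z, (adLogJord n ^ k) (Φ z) =
          thetaShift τ v z • (adLogJord n ^ k) X₀ := fun z => by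
        ext i j
        obtain ⟨a, ha⟩ := hscalar i j
        rw [hX₀, map_smul, Matrix.smul_apply, Matrix.smul_apply, ha, ha]
        simp only [smul_eq_mul]
        field_simp
      have hX₀k : (adLogJord n ^ (k + 1)) X₀ = 0 := by rw [hX₀, map_smul, hk, smul_zero]
      obtain ⟨X₁, hX₁⟩ := ih _ (Submodule.sub_mem _ hΦ (expNabla_mem_SolSpace hτ v X₀))
        fun z => by
          rw [Pi.sub_apply, map_sub, pow_adLogJord_expNabla hn τ v z hX₀k, hlead, sub_self]
      refine ⟨X₁ + X₀, fun z => ?_⟩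
      rw [map_add, ← hX₁, Pi.sub_apply, sub_add_cancel]
  exact key (2 * n) Φ hΦ fun z => by rw [adLogJord_pow, LinearMap.zero_apply]

/-- Δ maps into Sol_{J,v} and is a ℂ-linear isomorphism ℂ^{n²} ≃ Sol_{J,v}. -/
theorem Delta_isomorphism (n : ℕ) (hn : 1 ≤ n) (τ : ℂ) (hτ : 0 < τ.im) (v : ℂ) :
    (∀ u : Fin n × Fin n → ℂ,
      DeltaMap n τ v u ∈
        SolSpace n τ (Jord n) (fun z => -Complex.exp (-(2 * πc * I) * (z + v + τ)))) ∧
    ∃ Δ : (Fin n × Fin n → ℂ) ≃ₗ[ℂ]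
        ↥(SolSpace n τ (Jord n) (fun z => -Complex.exp (-(2 * πc * I) * (z + v + τ)))),
      ∀ u : Fin n × Fin n → ℂ,
        (Δ u : ℂ → Matrix (Fin n) (Fin n) ℂ) = DeltaMap n τ v u := by
  have hmem : ∀ u : Fin n × Fin n → ℂ,
      DeltaMap n τ v u ∈ SolSpace n τ (Jord n) (thetaFactor τ v) := fun u => by
    rw [DeltaMap_eq_expNabla]
    exact expNabla_mem_SolSpace hτ v _
  refine ⟨hmem, ?_⟩
  let Δ : (Fin n × Fin n → ℂ) →ₗ[ℂ] ↥(SolSpace n τ (Jord n) (thetaFactor τ v)) :=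
    { toFun := fun u => ⟨DeltaMap n τ v u, hmem u⟩
      map_add' := fun u w => Subtype.ext <| by
        simp only [DeltaMap_eq_expNabla, map_add]
        rfl
      map_smul' := fun a u => Subtype.ext <| by
        simp only [DeltaMap_eq_expNabla, map_smul]
        rfl }
  refine ⟨LinearEquiv.ofBijective Δ ⟨?_, ?_⟩, fun u => rfl⟩
  · refine (injective_iff_map_eq_zero Δ).mpr fun u hu => ?_
    have h : DeltaMap n τ v u = 0 := congrArg Subtype.val hu
    rw [DeltaMap_eq_expNabla] at h
    exact (vecToMatrix n).map_eq_zero_iff.mp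
      (expNabla_injective hn hτ v fun z => congrFun h z)
  · rintro ⟨Φ, hΦ⟩
    obtain ⟨X, hX⟩ := exists_eq_expNabla hn hτ v hΦ
    refine ⟨(vecToMatrix n).symm X, Subtype.ext ?_⟩
    change DeltaMap n τ v _ = Φ
    rw [DeltaMap_eq_expNabla, LinearEquiv.apply_symm_apply]
    exact (funext hX).symm
end
end

section
/- Let U ⊆ ℂ be open, f, g : U → ℂ holomorphic with g nowhere vanishing on U, and fix n ≥ 1 and 0 ≤ k, l ≤ n−1. Then, with the notation below, ∇_{k,l}(f/g) = Σ_{a=0}^{k} Σ_{b=0}^{l} [ ( Σ_{r=0}^{2n−1} (e_{l−b+1}ᵗ N_a^{(r)} e₁) · ∇^r(f)/r! ) · ( Σ_{χ=0}^{k−a+b} Σ_{(α,β) ∈ W^χ_{(k−a,b)}} (−1)^χ / g^{χ+1} · Π_{s=1}^{χ} ( Σ_{r_s=0}^{2n−1} (e_{β_s+1}ᵗ N_{α_s}^{(r_s)} e₁) · ∇^{r_s}(g)/r_s! ) ) ], as holomorphic functions on U. -/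
open Complex Matrix
open scoped TensorProduct

noncomputable section

/-- The differential operator ∇_{k,l}(h) = e_{n(n−k−1)+l+1}ᵗ·(exp(∇N)h)·e_{n(n−1)+1}, where
exp(∇N)h = Σ_m (∇^m h/m!)·N^m (a finite sum since N is nilpotent); the flattened index
n·r+c+1 corresponds to the pair (r,c) of 0-based indices. -/
def nablaKL (n : ℕ) (k l : Fin n) (h : ℂ → ℂ) : ℂ → ℂ :=
  fun z => ∑ m ∈ Finset.range (2 * n),
    ((m.factorial : ℂ))⁻¹ * (nabla^[m] h z) *
      ((Nmat n) ^ m)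
        ((⟨n - 1 - (k : ℕ), by have := k.isLt; omega⟩ : Fin n), l)
        ((⟨n - 1, by have := k.isLt; omega⟩ : Fin n),
          (⟨0, by have := k.isLt; omega⟩ : Fin n))

/-- W^χ_{(i,j)}: the set of χ-tuples (α_s,β_s) of pairs of natural numbers, none equal to
(0,0), with Σα_s = i and Σβ_s = j (encoded with α_s ≤ i, β_s ≤ j). -/
def Wpaths (i j χ : ℕ) : Finset (Fin χ → Fin (i + 1) × Fin (j + 1)) :=
  Finset.univ.filter fun s =>
    (∀ t, ¬(((s t).1 : ℕ) = 0 ∧ ((s t).2 : ℕ) = 0)) ∧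
    (∑ t, ((s t).1 : ℕ)) = i ∧ (∑ t, ((s t).2 : ℕ)) = j

open PowerSeries in
/-- The coefficient of `x ^ i * y ^ j` of a power series in two variables, `x` being the outer
variable and `y` the inner one. -/
def coeff₂ (i j : ℕ) : ℂ⟦X⟧⟦X⟧ →+ ℂ :=
  (PowerSeries.coeff (R := ℂ) j).toAddMonoidHom.comp
    (PowerSeries.coeff (R := ℂ⟦X⟧) i).toAddMonoidHom

section PowerSeries

open PowerSeries Finset

lemma coeff₂_apply (i j : ℕ) (φ : ℂ⟦X⟧⟦X⟧) : coeff₂ i j φ = coeff j (coeff i φ) := rfl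

lemma coeff₂_mul (i j : ℕ) (φ ψ : ℂ⟦X⟧⟦X⟧) :
    coeff₂ i j (φ * ψ) = ∑ p ∈ antidiagonal i, ∑ q ∈ antidiagonal j,
      coeff₂ p.1 q.1 φ * coeff₂ p.2 q.2 ψ := by
  simp [coeff₂_apply, PowerSeries.coeff_mul]

lemma coeff₂_C_mul (i j : ℕ) (c : ℂ) (φ : ℂ⟦X⟧⟦X⟧) :
    coeff₂ i j (C (C c) * φ) = c * coeff₂ i j φ := by
  simp [coeff₂_apply]

lemma coeff₂_C (i j : ℕ) (c : ℂ) :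
    coeff₂ i j (C (C c)) = if i = 0 ∧ j = 0 then c else 0 := by
  rw [coeff₂_apply, PowerSeries.coeff_C]
  split_ifs <;> simp_all [PowerSeries.coeff_C]

lemma coeff₂_one (i j : ℕ) : coeff₂ i j 1 = if i = 0 ∧ j = 0 then 1 else 0 := by
  simpa using coeff₂_C i j 1

lemma coeff₂_monomial (i j α β : ℕ) (c : ℂ) :
    coeff₂ i j (C (C c) * (C X ^ β * X ^ α)) = if α = i ∧ β = j then c else 0 := by
  rw [coeff₂_C_mul, coeff₂_apply, ← map_pow, PowerSeries.coeff_C_mul, PowerSeries.coeff_X_pow]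
  split_ifs <;> simp_all [PowerSeries.coeff_X_pow]
  intro h
  simp_all

lemma coeff₂_mul_congr {k l : ℕ} {φ φ' ψ ψ' : ℂ⟦X⟧⟦X⟧}
    (h : ∀ i ≤ k, ∀ j ≤ l, coeff₂ i j φ = coeff₂ i j φ')
    (h' : ∀ i ≤ k, ∀ j ≤ l, coeff₂ i j ψ = coeff₂ i j ψ') :
    ∀ i ≤ k, ∀ j ≤ l, coeff₂ i j (φ * ψ) = coeff₂ i j (φ' * ψ') := by
  intro i hi j hj
  rw [coeff₂_mul, coeff₂_mul]
  refine sum_congr rfl fun p hp => sum_congr rfl fun q hq => ?_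
  rw [HasAntidiagonal.mem_antidiagonal] at hp hq
  rw [h _ (by omega) _ (by omega), h' _ (by omega) _ (by omega)]

lemma coeff₂_pow_congr {k l : ℕ} {φ ψ : ℂ⟦X⟧⟦X⟧}
    (h : ∀ i ≤ k, ∀ j ≤ l, coeff₂ i j φ = coeff₂ i j ψ) (m : ℕ) :
    ∀ i ≤ k, ∀ j ≤ l, coeff₂ i j (φ ^ m) = coeff₂ i j (ψ ^ m) := by
  induction m with
  | zero => simp
  | succ m ih => simpa only [pow_succ] using coeff₂_mul_congr ih h

lemma coeff₂_mul_eq_zero {d e : ℕ} {φ ψ : ℂ⟦X⟧⟦X⟧}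
    (h : ∀ i j, i + j < d → coeff₂ i j φ = 0) (h' : ∀ i j, i + j < e → coeff₂ i j ψ = 0) :
    ∀ i j, i + j < d + e → coeff₂ i j (φ * ψ) = 0 := by
  intro i j hij
  rw [coeff₂_mul]
  refine sum_eq_zero fun p hp => sum_eq_zero fun q hq => ?_
  rw [HasAntidiagonal.mem_antidiagonal] at hp hq
  by_cases hd : p.1 + q.1 < d
  · rw [h _ _ hd, zero_mul]
  · rw [h' _ _ (by omega), mul_zero]

lemma coeff₂_pow_eq_zero {φ : ℂ⟦X⟧⟦X⟧} (h : coeff₂ 0 0 φ = 0) (m : ℕ) :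
    ∀ i j, i + j < m → coeff₂ i j (φ ^ m) = 0 := by
  induction m with
  | zero => simp
  | succ m ih =>
    rw [pow_succ]
    refine coeff₂_mul_eq_zero ih fun i j hij => ?_
    obtain ⟨rfl, rfl⟩ : i = 0 ∧ j = 0 := by omega
    exact h

/-- The coefficients of the powers of the part of `φ` without constant term. -/
lemma coeff₂_pow_sub_const (φ : ℂ⟦X⟧⟦X⟧) (i j χ : ℕ) :
    coeff₂ i j ((φ - C (C (coeff₂ 0 0 φ))) ^ χ) =
      ∑ s ∈ Wpaths i j χ, ∏ t, coeff₂ (s t).1 (s t).2 φ := by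
  let c : Fin (i + 1) × Fin (j + 1) → ℂ := fun w =>
    if (w.1 : ℕ) = 0 ∧ (w.2 : ℕ) = 0 then 0 else coeff₂ w.1 w.2 φ
  have htrunc : ∀ i' ≤ i, ∀ j' ≤ j, coeff₂ i' j' (φ - C (C (coeff₂ 0 0 φ))) =
      coeff₂ i' j' (∑ w : Fin (i + 1) × Fin (j + 1),
        C (C (c w)) * (C X ^ (w.2 : ℕ) * X ^ (w.1 : ℕ))) := by
    intro i' hi j' hj
    rw [map_sub, coeff₂_C, map_sum, Finset.sum_eq_single
      ((⟨i', by omega⟩, ⟨j', by omega⟩) : Fin (i + 1) × Fin (j + 1)), coeff₂_monomial]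
    · simp only [c]
      split_ifs <;> simp_all
    · rintro ⟨a, b⟩ - hab
      rw [coeff₂_monomial, if_neg]
      rintro ⟨rfl, rfl⟩
      exact hab rfl
    · simp
  rw [coeff₂_pow_congr htrunc χ i le_rfl j le_rfl, ← Fin.prod_const,
    Finset.prod_univ_sum, map_sum, Fintype.piFinset_univ, Wpaths, Finset.sum_filter]
  refine sum_congr rfl fun s _ => ?_
  rw [prod_mul_distrib, prod_mul_distrib, prod_pow_eq_pow_sum, prod_pow_eq_pow_sum,
    ← map_prod, ← map_prod, coeff₂_monomial]
  by_cases hs : ∀ t, ¬(((s t).1 : ℕ) = 0 ∧ ((s t).2 : ℕ) = 0)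
  · rw [prod_congr rfl fun t _ => if_neg (hs t)]
    simp only [hs, not_false_eq_true, implies_true, true_and]
  · push Not at hs
    obtain ⟨t, ht⟩ := hs
    have h0 : ∏ t, c (s t) = 0 := prod_eq_zero (mem_univ t) (if_pos ht)
    rw [h0, ite_self, if_neg fun h => h.1 t ht]

/-- The coefficients of `F / G`, the inverse of `G` being expanded as a geometric series. -/
lemma coeff₂_of_mul_eq {k l : ℕ} {Q F G : ℂ⟦X⟧⟦X⟧} {c : ℂ} (hc : c ≠ 0) (hG : coeff₂ 0 0 G = c)
    (h : ∀ i ≤ k, ∀ j ≤ l, coeff₂ i j (Q * G) = coeff₂ i j F) :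
    coeff₂ k l Q = ∑ p ∈ antidiagonal k, ∑ q ∈ antidiagonal l,
      coeff₂ p.1 q.1 F * ∑ χ ∈ range (p.2 + q.2 + 1), ∑ s ∈ Wpaths p.2 q.2 χ,
        (-1 : ℂ) ^ χ / c ^ (χ + 1) * ∏ t, coeff₂ (s t).1 (s t).2 G := by
  set H := G - C (C c) with hH
  have hH0 : coeff₂ 0 0 H = 0 := by
    rw [hH, map_sub, hG, coeff₂_C]
    simp
  let V : ℂ⟦X⟧⟦X⟧ := ∑ χ ∈ range (k + l + 1), C (C ((-1 : ℂ) ^ χ / c ^ (χ + 1))) * H ^ χ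
  have hGV : G * V = 1 - C (C ((-c⁻¹) ^ (k + l + 1))) * H ^ (k + l + 1) := by
    have hV : V = C (C c⁻¹) * ∑ χ ∈ range (k + l + 1), (C (C (-c⁻¹)) * H) ^ χ := by
      rw [mul_sum]
      refine sum_congr rfl fun χ _ => ?_
      rw [mul_pow, ← mul_assoc, ← map_pow, ← map_pow, ← map_mul, ← map_mul]
      congr 3
      rw [neg_pow c⁻¹, inv_pow, pow_succ]
      field_simp
    have hGc : G * C (C c⁻¹) = 1 - C (C (-c⁻¹)) * H := by
      have h1 : (C (C c) * C (C c⁻¹) : ℂ⟦X⟧⟦X⟧) = 1 := by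
        rw [← map_mul, ← map_mul, mul_inv_cancel₀ hc, map_one, map_one]
      rw [map_neg, map_neg, hH]
      linear_combination h1
    rw [hV, ← mul_assoc, hGc, mul_neg_geom_sum, mul_pow, map_pow, map_pow]
  have hQ : coeff₂ k l Q = coeff₂ k l (F * V) := by
    rw [← coeff₂_mul_congr h (fun _ _ _ _ => rfl) k le_rfl l le_rfl, mul_assoc, hGV, mul_sub,
      mul_one, map_sub, eq_comm, sub_eq_self, mul_left_comm, coeff₂_C_mul,
      coeff₂_mul_eq_zero (d := 0) (by simp) (coeff₂_pow_eq_zero hH0 (k + l + 1)) k l (by omega),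
      mul_zero]
  rw [hQ, coeff₂_mul]
  refine sum_congr rfl fun p hp => sum_congr rfl fun q hq => ?_
  rw [HasAntidiagonal.mem_antidiagonal] at hp hq
  congr 1
  rw [map_sum, ← sum_subset (range_mono (show p.2 + q.2 + 1 ≤ k + l + 1 by omega))]
  · refine sum_congr rfl fun χ _ => ?_
    rw [coeff₂_C_mul, ← mul_sum, ← coeff₂_pow_sub_const, hG]
  · intro χ _ hχ
    rw [mem_range, not_lt] at hχ
    rw [coeff₂_C_mul, coeff₂_pow_eq_zero hH0 _ _ _ (by omega), mul_zero]

/-- The matrix with rows and columns indexed by pairs which is block upper triangular and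
block-Toeplitz with lower triangular Toeplitz blocks, with entries the coefficients of `φ`. -/
def toeplitz (n : ℕ) (φ : ℂ⟦X⟧⟦X⟧) : Matrix (Fin n × Fin n) (Fin n × Fin n) ℂ :=
  Matrix.of fun p q => if p.1 ≤ q.1 ∧ q.2 ≤ p.2 then coeff₂ (q.1 - p.1) (p.2 - q.2) φ else 0

lemma sum_fin_toeplitz {n : ℕ} (p q : Fin n) (F : ℕ → ℕ → ℂ) :
    (∑ m : Fin n, if p ≤ m ∧ m ≤ q then F (m - p) (q - m) else 0) =
      if p ≤ q then ∑ a ∈ antidiagonal ((q : ℕ) - p), F a.1 a.2 else 0 := by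
  rw [← sum_filter]
  split_ifs with h
  · rw [Fin.le_def] at h
    refine sum_bij (fun m _ => ((m : ℕ) - p, (q : ℕ) - m)) ?_ ?_ ?_ ?_
    · intro m hm
      simp only [mem_filter, mem_univ, true_and, Fin.le_def, HasAntidiagonal.mem_antidiagonal] at hm ⊢
      omega
    · intro m hm m' hm' hmm
      simp only [mem_filter, mem_univ, true_and, Fin.le_def, Prod.mk.injEq] at hm hm' hmm
      omega
    · rintro ⟨a, b⟩ hab
      rw [HasAntidiagonal.mem_antidiagonal] at hab
      simp only at hab
      refine ⟨⟨p + a, by omega⟩, ?_, ?_⟩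
      · simp only [mem_filter, mem_univ, true_and, Fin.le_def]
        omega
      · simp only [Prod.mk.injEq]
        omega
    · intros
      rfl
  · refine sum_eq_zero fun m hm => ?_
    simp only [mem_filter, mem_univ, true_and] at hm
    exact absurd (hm.1.trans hm.2) h

lemma toeplitz_one (n : ℕ) : toeplitz n 1 = 1 := by
  ext ⟨p, u⟩ ⟨q, v⟩
  simp only [toeplitz, Matrix.of_apply, coeff₂_one, Matrix.one_apply, Prod.mk.injEq, Fin.le_def,
    Fin.ext_iff]
  split_ifs <;> first | rfl | omega

lemma toeplitz_mul (n : ℕ) (φ ψ : ℂ⟦X⟧⟦X⟧) :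
    toeplitz n (φ * ψ) = toeplitz n φ * toeplitz n ψ := by
  ext ⟨p, u⟩ ⟨q, v⟩
  have hrev : ∀ F : ℕ → ℕ → ℂ, ∑ a ∈ antidiagonal ((u : ℕ) - v), F a.1 a.2 =
      ∑ a ∈ antidiagonal ((u : ℕ) - v), F a.2 a.1 := fun F =>
    (Nat.sum_antidiagonal_swap (f := fun a : ℕ × ℕ => F a.1 a.2)).symm
  have hinner : ∀ a b : ℕ, (∑ w : Fin n, if v ≤ w ∧ w ≤ u then
      coeff₂ a (u - w) φ * coeff₂ b (w - v) ψ else 0) =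
      if v ≤ u then ∑ c ∈ antidiagonal ((u : ℕ) - v), coeff₂ a c.1 φ * coeff₂ b c.2 ψ else 0 := by
    intro a b
    rw [sum_fin_toeplitz v u fun x y => coeff₂ a y φ * coeff₂ b x ψ,
      hrev fun x y => coeff₂ a y φ * coeff₂ b x ψ]
  have houter := sum_fin_toeplitz p q fun a b => ∑ w : Fin n, if v ≤ w ∧ w ≤ u then
      coeff₂ a (u - w) φ * coeff₂ b (w - v) ψ else 0
  rw [Matrix.mul_apply, Fintype.sum_prod_type]
  calc toeplitz n (φ * ψ) (p, u) (q, v)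
      = if p ≤ q then ∑ a ∈ antidiagonal ((q : ℕ) - p),
          (if v ≤ u then ∑ c ∈ antidiagonal ((u : ℕ) - v),
            coeff₂ a.1 c.1 φ * coeff₂ a.2 c.2 ψ else 0) else 0 := by
        simp only [toeplitz, Matrix.of_apply, coeff₂_mul]
        split_ifs <;> simp_all
    _ = _ := by
        simp only [← hinner]
        rw [← houter]
        refine sum_congr rfl fun m _ => ?_
        by_cases hm : p ≤ m ∧ m ≤ q
        · rw [if_pos hm]
          refine sum_congr rfl fun w _ => ?_
          by_cases hw : v ≤ w ∧ w ≤ u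
          · simp [toeplitz, hm, hw]
          · rw [if_neg hw]
            simp only [toeplitz, Matrix.of_apply, hm, true_and]
            grind
        · rw [if_neg hm]
          refine (sum_eq_zero fun w _ => ?_).symm
          simp only [toeplitz, Matrix.of_apply]
          grind

lemma toeplitz_pow (n : ℕ) (φ : ℂ⟦X⟧⟦X⟧) (r : ℕ) : toeplitz n φ ^ r = toeplitz n (φ ^ r) := by
  induction r with
  | zero => rw [pow_zero, pow_zero, toeplitz_one]
  | succ r ih => rw [pow_succ, pow_succ, ih, toeplitz_mul]

/-- The power series `log (1 + x) - log (1 + y)`. -/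
def logDiff : ℂ⟦X⟧⟦X⟧ :=
  PowerSeries.mk fun i => PowerSeries.mk fun j =>
    if i = 0 then (-1 : ℂ) ^ j / j else if j = 0 then -((-1 : ℂ) ^ i / i) else 0

lemma coeff₂_logDiff (i j : ℕ) : coeff₂ i j logDiff =
    if i = 0 then (-1 : ℂ) ^ j / j else if j = 0 then -((-1 : ℂ) ^ i / i) else 0 := by
  rw [coeff₂_apply, logDiff, coeff_mk, coeff_mk]

lemma coeff₂_logDiff_pow (m i j : ℕ) (h : i + j < m) : coeff₂ i j (logDiff ^ m) = 0 :=
  coeff₂_pow_eq_zero (by simp [coeff₂_logDiff]) m i j h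

lemma Nmat_eq_toeplitz (n : ℕ) : Nmat n = toeplitz n logDiff := by
  ext ⟨p, u⟩ ⟨q, v⟩
  simp only [Nmat, toeplitz, Ablock, Matrix.of_apply, coeff₂_logDiff, Fin.le_def]
  by_cases hpq : (p : ℕ) ≤ q
  · by_cases h0 : (q : ℕ) - p = 0
    · rcases lt_trichotomy (v : ℕ) u with h | h | h
      · have h' : v < u := h
        simp [hpq, h0, h', h'.le]
      · simp [hpq, h0, h]
      · have h' : u < v := h
        simp [hpq, h0, h'.not_gt, h'.not_ge]
    · rcases lt_trichotomy (v : ℕ) u with h | h | h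
      · have : u ≠ v := fun e => by simp [e] at h
        simp [hpq, h0, h.le, this, Nat.sub_eq_zero_iff_le, h.not_ge]
      · obtain rfl : v = u := Fin.ext h
        simp [hpq, h0]
      · have : u ≠ v := fun e => by simp [e] at h
        simp [hpq, h0, h.not_ge, this]
  · simp [hpq]

lemma Nmat_pow_apply (n r : ℕ) (p u q v : Fin n) :
    (Nmat n ^ r) (p, u) (q, v) =
      if p ≤ q ∧ v ≤ u then coeff₂ (q - p) (u - v) (logDiff ^ r) else 0 := by
  rw [Nmat_eq_toeplitz, toeplitz_pow, toeplitz, Matrix.of_apply]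

/-- The truncation to order `M` of the power series `exp (∇ * logDiff) h` at `z`. -/
def taylor (M : ℕ) (z : ℂ) (h : ℂ → ℂ) : ℂ⟦X⟧⟦X⟧ :=
  ∑ r ∈ range M, C (C (nabla^[r] h z / r.factorial)) * logDiff ^ r

lemma coeff₂_taylor (M : ℕ) (z : ℂ) (h : ℂ → ℂ) (i j : ℕ) :
    coeff₂ i j (taylor M z h) =
      ∑ r ∈ range M, nabla^[r] h z / r.factorial * coeff₂ i j (logDiff ^ r) := by
  simp only [taylor, map_sum, coeff₂_C_mul]

lemma nabla_iterate (h : ℂ → ℂ) (r : ℕ) (z : ℂ) :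
    nabla^[r] h z = (-(1 / (2 * πc * I))) ^ r * iteratedDeriv r h z := by
  induction r generalizing z with
  | zero => simp
  | succ r ih =>
    rw [Function.iterate_succ_apply', nabla, funext ih, deriv_const_mul_field, iteratedDeriv_succ]
    ring

lemma nabla_iterate_mul {u v : ℂ → ℂ} {z : ℂ} (hu : AnalyticAt ℂ u z) (hv : AnalyticAt ℂ v z)
    (r : ℕ) : nabla^[r] (u * v) z / r.factorial = ∑ p ∈ antidiagonal r,
      nabla^[p.1] u z / p.1.factorial * (nabla^[p.2] v z / p.2.factorial) := by
  rw [nabla_iterate, iteratedDeriv_mul hu.contDiffAt hv.contDiffAt, mul_sum, sum_div,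
    Nat.sum_antidiagonal_eq_sum_range_succ_mk]
  refine sum_congr rfl fun i hi => ?_
  have hir : i ≤ r := Nat.lt_succ_iff.mp (mem_range.mp hi)
  have hfac : ((r.choose i : ℕ) : ℂ) * i.factorial * (r - i).factorial = r.factorial := by
    exact_mod_cast Nat.choose_mul_factorial_mul_factorial hir
  have h1 : (i.factorial : ℂ) ≠ 0 := by exact_mod_cast i.factorial_ne_zero
  have h2 : ((r - i).factorial : ℂ) ≠ 0 := by exact_mod_cast (r - i).factorial_ne_zero
  have h3 : (r.factorial : ℂ) ≠ 0 := by exact_mod_cast r.factorial_ne_zero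
  rw [nabla_iterate, nabla_iterate, div_mul_div_comm, div_eq_div_iff h3 (mul_ne_zero h1 h2),
    ← hfac]
  nth_rewrite 1 [← Nat.add_sub_cancel' hir]
  rw [pow_add]
  ring

lemma coeff₂_taylor_mul {u v : ℂ → ℂ} {z : ℂ} (hu : AnalyticAt ℂ u z) (hv : AnalyticAt ℂ v z)
    {M i j : ℕ} (hM : i + j < M) :
    coeff₂ i j (taylor M z (u * v)) = coeff₂ i j (taylor M z u * taylor M z v) := by
  have hprod : taylor M z u * taylor M z v = ∑ p ∈ range M ×ˢ range M,
      C (C (nabla^[p.1] u z / p.1.factorial * (nabla^[p.2] v z / p.2.factorial))) *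
        logDiff ^ (p.1 + p.2) := by
    rw [taylor, taylor, sum_mul_sum, sum_product]
    refine sum_congr rfl fun r _ => sum_congr rfl fun s _ => ?_
    rw [map_mul, map_mul, pow_add]
    ring
  rw [hprod, map_sum, coeff₂_taylor]
  simp only [coeff₂_C_mul, nabla_iterate_mul hu hv, sum_mul]
  rw [sum_sigma']
  refine sum_of_injOn (fun x => x.2) ?_ ?_ ?_ ?_
  · rintro ⟨r, p⟩ hx ⟨r', p'⟩ hx' rfl
    simp only [coe_sigma, Set.mem_sigma_iff, mem_coe, HasAntidiagonal.mem_antidiagonal] at hx hx'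
    obtain rfl : r = r' := hx.2.symm.trans hx'.2
    rfl
  · rintro ⟨r, p⟩ hx
    simp only [coe_sigma, Set.mem_sigma_iff, mem_coe, HasAntidiagonal.mem_antidiagonal, mem_range] at hx
    simp only [mem_coe, mem_product, mem_range]
    omega
  · rintro p - hp
    rw [coeff₂_logDiff_pow, mul_zero]
    by_contra hlt
    refine hp ⟨⟨p.1 + p.2, p⟩, ?_, rfl⟩
    simp only [coe_sigma, Set.mem_sigma_iff, mem_coe, HasAntidiagonal.mem_antidiagonal, mem_range, and_true]
    omega
  · rintro ⟨r, p⟩ hx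
    simp only [mem_sigma, HasAntidiagonal.mem_antidiagonal] at hx
    simp only [hx.2]

lemma taylor_congr {u v : ℂ → ℂ} {z : ℂ} (h : u =ᶠ[nhds z] v) (M : ℕ) :
    taylor M z u = taylor M z v := by
  simp only [taylor, nabla_iterate, h.iteratedDeriv_eq]

lemma coeff₂_zero_taylor (M : ℕ) (z : ℂ) (h : ℂ → ℂ) :
    coeff₂ 0 0 (taylor (M + 1) z h) = h z := by
  rw [coeff₂_taylor, sum_range_succ', sum_eq_zero]
  · simp [coeff₂_one]
  · intro r _
    rw [coeff₂_logDiff_pow _ _ _ (by omega), mul_zero]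

lemma sum_Nmat_eq_coeff₂_taylor {n : ℕ} (hn : 0 < n) (i j : Fin n) (z : ℂ) (h : ℂ → ℂ) :
    ∑ r ∈ range (2 * n), (Nmat n ^ r) (⟨0, hn⟩, j) (i, ⟨0, hn⟩) * nabla^[r] h z / r.factorial =
      coeff₂ i j (taylor (2 * n) z h) := by
  rw [coeff₂_taylor]
  refine sum_congr rfl fun r _ => ?_
  rw [Nmat_pow_apply, if_pos ⟨Nat.zero_le _, Nat.zero_le _⟩, mul_div_assoc, mul_comm]
  simp

lemma nablaKL_eq_coeff₂_taylor {n : ℕ} (k l : Fin n) (z : ℂ) (h : ℂ → ℂ) :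
    nablaKL n k l h z = coeff₂ k l (taylor (2 * n) z h) := by
  rw [coeff₂_taylor, nablaKL]
  refine sum_congr rfl fun r _ => ?_
  have hk : n - 1 - (n - 1 - (k : ℕ)) = k := by omega
  rw [Nmat_pow_apply, if_pos ⟨Nat.sub_le _ _, Nat.zero_le _⟩, hk, Nat.sub_zero]
  ring

lemma sum_antidiagonal_eq_sum_fin {n : ℕ} (k : Fin n) (F : ℕ → ℕ → ℂ) :
    ∑ p ∈ antidiagonal (k : ℕ), F p.1 p.2 =
      ∑ a : Fin n, if (a : ℕ) ≤ k then F a (k - a) else 0 := by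
  have h := sum_fin_toeplitz ⟨0, k.pos⟩ k F
  simp only [Fin.le_def, Nat.zero_le, true_and, if_true, Nat.sub_zero] at h
  exact h.symm

end PowerSeries

/-- The generalized Leibniz formula for ∇_{k,l}(f/g); here N_i^{(r)} denotes the
(1,i+1)-block of N^r, i.e. (N^r)((0,·),(i,·)). -/
theorem nablaKL_quotient_formula (n : ℕ) (U : Set ℂ) (hU : IsOpen U) (f g : ℂ → ℂ)
    (hf : DifferentiableOn ℂ f U) (hg : DifferentiableOn ℂ g U)
    (hgz : ∀ z ∈ U, g z ≠ 0) (k l : Fin n) :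
    ∀ z ∈ U,
      nablaKL n k l (fun w => f w / g w) z =
        ∑ a : Fin n, ∑ b : Fin n,
          if (a : ℕ) ≤ (k : ℕ) ∧ (b : ℕ) ≤ (l : ℕ) then
            (∑ r ∈ Finset.range (2 * n),
                ((Nmat n) ^ r)
                  ((⟨0, by have := k.isLt; omega⟩ : Fin n),
                    (⟨(l : ℕ) - (b : ℕ), by have := l.isLt; omega⟩ : Fin n))
                  (a, (⟨0, by have := k.isLt; omega⟩ : Fin n)) *
                (nabla^[r] f z) / (r.factorial : ℂ)) *
            ∑ χ ∈ Finset.range ((k : ℕ) - (a : ℕ) + (b : ℕ) + 1),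
              ∑ s ∈ Wpaths ((k : ℕ) - (a : ℕ)) (b : ℕ) χ,
                (-1 : ℂ) ^ χ / (g z) ^ (χ + 1) *
                  ∏ t : Fin χ,
                    ∑ r ∈ Finset.range (2 * n),
                      ((Nmat n) ^ r)
                        ((⟨0, by have := k.isLt; omega⟩ : Fin n),
                          (⟨((s t).2 : ℕ), by have h1 := (s t).2.isLt; have h2 := b.isLt; omega⟩ : Fin n))
                        ((⟨((s t).1 : ℕ), by have h1 := (s t).1.isLt; have h2 := k.isLt; omega⟩ : Fin n),
                          (⟨0, by have := k.isLt; omega⟩ : Fin n)) *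
                      (nabla^[r] g z) / (r.factorial : ℂ)
          else 0 := by
  intro z hz
  have hn : 0 < n := k.pos
  have hfz : AnalyticAt ℂ f z := hf.analyticAt (hU.mem_nhds hz)
  have hgz' : AnalyticAt ℂ g z := hg.analyticAt (hU.mem_nhds hz)
  have hqz : AnalyticAt ℂ (fun w => f w / g w) z := hfz.div hgz' (hgz z hz)
  have heq : (fun w => f w / g w) * g =ᶠ[nhds z] f := by
    filter_upwards [hU.mem_nhds hz] with w hw
    exact div_mul_cancel₀ _ (hgz w hw)
  have hG : coeff₂ 0 0 (taylor (2 * n) z g) = g z := by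
    obtain ⟨M, hM⟩ : ∃ M, 2 * n = M + 1 := ⟨2 * n - 1, by omega⟩
    rw [hM, coeff₂_zero_taylor]
  rw [nablaKL_eq_coeff₂_taylor, coeff₂_of_mul_eq (F := taylor (2 * n) z f) (hgz z hz) hG]
  · rw [sum_antidiagonal_eq_sum_fin k fun x y => ∑ q ∈ Finset.HasAntidiagonal.antidiagonal (l : ℕ),
      coeff₂ x q.1 (taylor (2 * n) z f) * ∑ χ ∈ Finset.range (y + q.2 + 1),
        ∑ s ∈ Wpaths y q.2 χ, (-1 : ℂ) ^ χ / g z ^ (χ + 1) *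
          ∏ t, coeff₂ (s t).1 (s t).2 (taylor (2 * n) z g)]
    refine Finset.sum_congr rfl fun a _ => ?_
    split_ifs with hak
    · rw [← Finset.Nat.sum_antidiagonal_swap]
      refine (sum_antidiagonal_eq_sum_fin l fun y x => coeff₂ a x (taylor (2 * n) z f) *
          ∑ χ ∈ Finset.range ((k : ℕ) - a + y + 1), ∑ s ∈ Wpaths ((k : ℕ) - a) y χ,
            (-1 : ℂ) ^ χ / g z ^ (χ + 1) *
              ∏ t, coeff₂ (s t).1 (s t).2 (taylor (2 * n) z g)).trans ?_
      refine Finset.sum_congr rfl fun b _ => ?_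
      simp only [hak, true_and]
      split_ifs with hbl
      · rw [sum_Nmat_eq_coeff₂_taylor hn]
        congr 1
        refine Finset.sum_congr rfl fun χ _ => Finset.sum_congr rfl fun s _ => ?_
        congr 1
        refine Finset.prod_congr rfl fun t _ => ?_
        rw [sum_Nmat_eq_coeff₂_taylor hn]
      · rfl
    · simp [hak]
  · intro i hi j hj
    rw [← coeff₂_taylor_mul hqz hgz' (by omega), taylor_congr heq]
end
end
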